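/- arXiv:2406.13592 — 2 statements merged into one kernel-verified Lean document; each statement's English description precedes it below -/
import Mathlib

section
/- Let g = g₁ + 2g₂ and let F be the free group on generators x₁, …, x_g. Let φ be the automorphism of F determined by φ(xᵢ) = xᵢ⁻¹ for 1 ≤ i ≤ g₁, φ(xᵢ) = x_{i+g₂} for g₁ < i ≤ g₁ + g₂, and φ(xᵢ) = x_{i−g₂} for g₁ + g₂ < i ≤ g. Then φ has no nontrivial fixed point: if w ∈ F and φ(w) = w, then w is the identity. -/
namespace FreeGroup

variable {α : Type*}

/-- An endomorphism sending each generator `a` to the letter `s a` acts letterwise on words. -/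
theorem map_mk_of_letters {φ : FreeGroup α →* FreeGroup α} {s : α → α × Bool}
    (hs : ∀ a, φ (of a) = mk [s a]) (L : List (α × Bool)) :
    φ (mk L) = mk (L.map fun x => ((s x.1).1, x.2 == (s x.1).2)) := by
  induction L with
  | nil => exact _root_.map_one φ
  | cons x L ih =>
    obtain ⟨a, b⟩ := x
    have hx : φ (mk [(a, b)]) = mk [((s a).1, b == (s a).2)] := by
      cases b
      · have h : mk [(a, false)] = (of a)⁻¹ := by simp [of, invRev]
        rw [h, _root_.map_inv, hs, inv_mk]
        simp [invRev]
      · simpa [of] using hs a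
    rw [← List.singleton_append, ← mul_mk, _root_.map_mul, ih, hx, mul_mk]
    rfl

/-- If an injective endomorphism sends generators to letters, then distinct generators go to
letters on distinct generators. -/
theorem injective_fst_of_letters {φ : FreeGroup α →* FreeGroup α} (hφ : Function.Injective φ)
    {s : α → α × Bool} (hs : ∀ a, φ (of a) = mk [s a]) :
    Function.Injective fun a => (s a).1 := by
  classical
  intro a b hab
  have h : φ (mk [(a, true)]) = φ (mk [(b, (s a).2 == (s b).2)]) := by
    rw [map_mk_of_letters hs, map_mk_of_letters hs]
    have hab' : (s a).1 = (s b).1 := hab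
    simp only [List.map_cons, List.map_nil, hab']
    cases (s a).2 <;> cases (s b).2 <;> rfl
  have h' := reduce.sound (hφ h)
  simp only [reduce_singleton] at h'
  simp_all

/-- An injective endomorphism of a free group sending every generator to a letter different
from that generator has no nontrivial fixed point. -/
theorem eq_one_of_map_eq_self {φ : FreeGroup α →* FreeGroup α} (hφ : Function.Injective φ)
    {s : α → α × Bool} (hs : ∀ a, φ (of a) = mk [s a]) (hne : ∀ a, s a ≠ (a, true))
    {w : FreeGroup α} (hw : φ w = w) : w = 1 := by
  classical
  have hred : IsReduced (w.toWord.map fun x => ((s x.1).1, x.2 == (s x.1).2)) := by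
    refine List.isChain_map_of_isChain _ (fun x y hxy h => ?_) (isReduced_toWord (x := w))
    have h1 : x.1 = y.1 := injective_fst_of_letters hφ hs h
    simp only [h1, hxy h1]
  have hfix : w.toWord.map (fun x => ((s x.1).1, x.2 == (s x.1).2)) = w.toWord := by
    rw [← hred.reduce_eq, ← toWord_mk, ← map_mk_of_letters hs, mk_toWord, hw]
  rw [← toWord_eq_nil_iff]
  rcases hL : w.toWord with _ | ⟨⟨a, b⟩, L⟩
  · rfl
  · rw [hL] at hfix
    simp only [List.map_cons, List.cons.injEq, Prod.mk.injEq] at hfix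
    refine absurd (Prod.ext hfix.1.1 ?_) (hne a)
    have h := hfix.1.2
    revert h
    cases b <;> cases (s a).2 <;> simp

end FreeGroup

/-- **No nontrivial fixed points**: the automorphism `φ` of the free group on
`g = g₁ + 2g₂` generators with `φ(xᵢ) = xᵢ⁻¹` for `i < g₁`, `φ(xᵢ) = x_{i+g₂}` for
`g₁ ≤ i < g₁ + g₂` and `φ(xᵢ) = x_{i−g₂}` for `g₁ + g₂ ≤ i` fixes only the identity. -/
theorem stmt_8 (g₁ g₂ : ℕ)
    (φ : FreeGroup (Fin (g₁ + 2 * g₂)) ≃* FreeGroup (Fin (g₁ + 2 * g₂)))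
    (h1 : ∀ i : Fin (g₁ + 2 * g₂), (i : ℕ) < g₁ →
      φ (FreeGroup.of i) = (FreeGroup.of i)⁻¹)
    (h2 : ∀ i j : Fin (g₁ + 2 * g₂), g₁ ≤ (i : ℕ) → (i : ℕ) < g₁ + g₂ →
      (j : ℕ) = (i : ℕ) + g₂ → φ (FreeGroup.of i) = FreeGroup.of j)
    (h3 : ∀ i j : Fin (g₁ + 2 * g₂), g₁ + g₂ ≤ (i : ℕ) →
      (j : ℕ) + g₂ = (i : ℕ) → φ (FreeGroup.of i) = FreeGroup.of j)
    (w : FreeGroup (Fin (g₁ + 2 * g₂))) (hw : φ w = w) : w = 1 := by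
  have hletter : ∀ i, ∃ p : Fin (g₁ + 2 * g₂) × Bool,
      φ (FreeGroup.of i) = FreeGroup.mk [p] ∧ p ≠ (i, true) := by
    intro i
    by_cases hi : (i : ℕ) < g₁
    · exact ⟨(i, false), by rw [h1 i hi]; rfl, by simp⟩
    by_cases hi' : (i : ℕ) < g₁ + g₂
    · refine ⟨(⟨i + g₂, by omega⟩, true), h2 i _ (by omega) hi' rfl, ?_⟩
      simp only [ne_eq, Prod.mk.injEq, Fin.ext_iff]
      omega
    · refine ⟨(⟨i - g₂, by omega⟩, true), h3 i _ (by omega) (by simp only; omega), ?_⟩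
      simp only [ne_eq, Prod.mk.injEq, Fin.ext_iff]
      omega
  choose s hs hne using hletter
  exact FreeGroup.eq_one_of_map_eq_self (φ := φ.toMonoidHom) φ.injective hs hne hw
end

section
/- An admissible T̃ move on a strongly involutive link L factorizes into admissible R̃ moves and admissible W̃ moves and their inverses. -/
open Set

noncomputable section

/-- Points of `ℝ³`, written `(x, y, z)`. -/
abbrev R3 := ℝ × ℝ × ℝ

/-- The involution of `ℝ³` given by the π-rotation around the y-axis. -/
def tau : R3 → R3 := fun p => (-p.1, p.2.1, -p.2.2)

/-- The fixed-point axis `𝐚` of `tau` (the y-axis). -/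
def axisA : Set R3 := {p | p.1 = 0 ∧ p.2.2 = 0}

/-- The braid axis `𝐛` (the z-axis). -/
def axisB : Set R3 := {p | p.1 = 0 ∧ p.2.1 = 0}

/-- Orthogonal projection to the (x,y)-plane (the plane of link diagrams). -/
def proj (p : R3) : ℝ × ℝ := (p.1, p.2.1)

/-- Planar cross product, used to detect the sense of rotation around the origin. -/
def cross2 (u v : ℝ × ℝ) : ℝ := u.1 * v.2 - u.2 * v.1

/-- An oriented edge is positive if its projection runs counterclockwise around the origin. -/
def PosEdge (e : R3 × R3) : Prop := 0 < cross2 (proj e.1) (proj e.2)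

/-- An oriented edge is negative if its projection runs clockwise around the origin. -/
def NegEdge (e : R3 × R3) : Prop := cross2 (proj e.1) (proj e.2) < 0

/-- The (possibly degenerate) triangle with vertices `a`, `b`, `c`. -/
def tri (a b c : R3) : Set R3 := convexHull ℝ ({a, b, c} : Set R3)

/-- A polygonal link, presented by its finite list of oriented edges. -/
abbrev PolyLink := List (R3 × R3)

/-- The underlying subset of `ℝ³` of a polygonal link. -/
def carrier (L : PolyLink) : Set R3 := ⋃ e ∈ L, segment ℝ e.1 e.2

/-- The edge list describes an embedded disjoint union of polygonal circles. -/
def IsLink (L : PolyLink) : Prop :=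
  L.Nodup ∧ (∀ e ∈ L, e.1 ≠ e.2) ∧
  (∀ e ∈ L, ∀ f ∈ L, e ≠ f →
    segment ℝ e.1 e.2 ∩ segment ℝ f.1 f.2 ⊆ ({e.1, e.2} : Set R3) ∩ ({f.1, f.2} : Set R3)) ∧
  (∀ e ∈ L, ∃! f, f ∈ L ∧ f.1 = e.2) ∧
  (∀ e ∈ L, ∃! f, f ∈ L ∧ f.2 = e.1)

/-- `L` is preserved setwise by `tau`, with the orientation reversed. -/
def StronglyInvolutive (L : PolyLink) : Prop := ∀ e ∈ L, (tau e.2, tau e.1) ∈ L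

/-- The standing assumption on diagrams: no edge projects into a line through the origin,
and the projection has only double points. -/
def GoodDiagram (L : PolyLink) : Prop :=
  (∀ e ∈ L, cross2 (proj e.1) (proj e.2) ≠ 0) ∧
  (∀ p : ℝ × ℝ, ({x ∈ carrier L | proj x = p}).ncard ≤ 2)

open scoped Classical in
/-- The complexity `h(L)`: the number of negative edges of `L`. -/
def hNeg (L : PolyLink) : ℕ := L.countP fun e => decide (NegEdge e)

/-! ### The elementary moves -/

/-- The result of the triangle move `E_{a,c}^b`: the edge `(a,c)` is replaced by
`(a,b)` and `(b,c)`. -/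
def applyE (a c b : R3) (L : PolyLink) : PolyLink := L.erase (a, c) ++ [(a, b), (b, c)]

/-- The move `E_{a,c}^b` is defined: `a, c` are consecutive vertices and the result is a link. -/
def MoveEOk (a c b : R3) (L : PolyLink) : Prop := (a, c) ∈ L ∧ IsLink (applyE a c b L)

/-- Admissibility of `E_{a,c}^b` (not through `∞`): `[a,b,c] ∩ L = [a,c]`. -/
def AdmE (a c b : R3) (L : PolyLink) : Prop :=
  MoveEOk a c b L ∧ tri a b c ∩ carrier L = segment ℝ a c

/-- Admissibility of an `E` move going through `∞`: the plane through `a`, `b`, `c` meets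
`L ∖ [a,c]` only inside the interior of the triangle `[a,b,c]`. -/
def AdmEInf (a c b : R3) (L : PolyLink) : Prop :=
  MoveEOk a c b L ∧ ¬ Collinear ℝ ({a, b, c} : Set R3) ∧ b ∉ carrier L ∧
  (affineSpan ℝ ({a, b, c} : Set R3) : Set R3) ∩ (carrier L \ segment ℝ a c)
    ⊆ intrinsicInterior ℝ (tri a b c)

/-- The equivariant triangle move `Ẽ_{a,c}^b = E_{τ(a),τ(c)}^{τ(b)} ∘ E_{a,c}^b`. -/
def applyEtil (a c b : R3) (L : PolyLink) : PolyLink :=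
  applyE (tau c) (tau a) (tau b) (applyE a c b L)

/-- Admissibility of the equivariant triangle move `Ẽ_{a,c}^b`. -/
def AdmEtil (a c b : R3) (L : PolyLink) : Prop :=
  AdmE a c b L ∧ AdmE (tau c) (tau a) (tau b) (applyE a c b L)

/-- The quadrilateral `Q` with vertices `a`, `b`, `c`, `τ(a)` of a `D` move. -/
def quadD (a c b : R3) : Set R3 := convexHull ℝ ({a, b, c, tau a} : Set R3)

/-- The τ-symmetric quadrilateral move `D_{a,c}^b`, replacing `[a,c] ∪ [c,τ(a)]` by
`[a,b] ∪ [b,τ(a)]`, where `b` lies on the axis `𝐚`. -/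
def applyD (a c b : R3) (L : PolyLink) : PolyLink :=
  ((L.erase (a, c)).erase (c, tau a)) ++ [(a, b), (b, tau a)]

/-- The move `D_{a,c}^b` is defined. -/
def MoveDOk (a c b : R3) (L : PolyLink) : Prop :=
  (a, c) ∈ L ∧ (c, tau a) ∈ L ∧ b ∈ axisA ∧ Coplanar ℝ ({a, b, c, tau a} : Set R3) ∧
  IsLink (applyD a c b L)

/-- Admissibility of `D_{a,c}^b` (not through `∞`): `Q ∩ L = [a,c] ∪ [c,τ(a)]`. -/
def AdmD (a c b : R3) (L : PolyLink) : Prop :=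
  MoveDOk a c b L ∧ quadD a c b ∩ carrier L = segment ℝ a c ∪ segment ℝ c (tau a)

/-- Admissibility of a `D` move going through `∞`: the closure of `(α ∖ Q) ∩ L` equals
`[a,c] ∪ [c,τ(a)]`, where `α` is the plane of `Q`. -/
def AdmDInf (a c b : R3) (L : PolyLink) : Prop :=
  MoveDOk a c b L ∧
  closure (((affineSpan ℝ ({a, b, c, tau a} : Set R3) : Set R3) \ quadD a c b) ∩ carrier L)
    = segment ℝ a c ∪ segment ℝ c (tau a)

/-! ### `R`-type moves (all involved edges positive) -/

/-- An `R̃` move: an admissible `Ẽ_{a,c}^b` whose edges `ab`, `ac`, `cb` are all positive. -/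
def AdmRtil (a c b : R3) (L : PolyLink) : Prop :=
  AdmEtil a c b L ∧ PosEdge (a, b) ∧ PosEdge (a, c) ∧ PosEdge (c, b)

/-- An `R` move: an admissible `D_{a,c}^b` (not through `∞`) with `ac`, `ab` positive. -/
def AdmR (a c b : R3) (L : PolyLink) : Prop :=
  AdmD a c b L ∧ PosEdge (a, c) ∧ PosEdge (a, b)

/-! ### `W`-type moves -/

/-- The move `W̃_{a,d}^{b,c} = Ẽ_{b,d}^c ∘ Ẽ_{a,d}^b`. -/
def applyWtil (a d b c : R3) (L : PolyLink) : PolyLink := applyEtil b d c (applyEtil a d b L)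

/-- Admissibility of `W̃_{a,d}^{b,c}`. -/
def AdmWtil (a d b c : R3) (L : PolyLink) : Prop :=
  PosEdge (a, b) ∧ PosEdge (b, c) ∧ PosEdge (c, d) ∧ PosEdge (a, d) ∧ PosEdge (d, b) ∧
  AdmEtil a d b L ∧ AdmEtil b d c (applyEtil a d b L)

/-- The move `W_{a,d}^{b,c} = D_{b,d}^c ∘ Ẽ_{a,d}^b` (with `c = τ(c)`, `d = τ(d)`). -/
def applyW (a d b c : R3) (L : PolyLink) : PolyLink := applyD b d c (applyEtil a d b L)

/-- Admissibility of `W_{a,d}^{b,c}` not going through `∞`. -/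
def AdmW (a d b c : R3) (L : PolyLink) : Prop :=
  c = tau c ∧ d = tau d ∧
  PosEdge (a, b) ∧ PosEdge (d, b) ∧ PosEdge (c, a) ∧ PosEdge (b, c) ∧
  AdmEtil a d b L ∧ AdmD b d c (applyEtil a d b L)

/-- Admissibility of `W_{a,d}^{b,c}` going through `∞`. -/
def AdmWInf (a d b c : R3) (L : PolyLink) : Prop :=
  c = tau c ∧ d = tau d ∧
  PosEdge (a, b) ∧ PosEdge (d, b) ∧ PosEdge (c, a) ∧ PosEdge (b, c) ∧
  AdmEtil a d b L ∧ AdmDInf b d c (applyEtil a d b L)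

/-- The support of `W̃_{a,d}^{b,c}`. -/
def suppWtil (a d b c : R3) : Set R3 := convexHull ℝ ({a, b, c, d} : Set R3)

/-- The support of a `W` move not going through `∞`. -/
def suppW (a d b c : R3) : Set R3 := convexHull ℝ ({a, b, c, tau a, tau b} : Set R3)

/-- The hexagon `[a,c,τ(a),b,τ(b),d]`. -/
def hexW (a d b c : R3) : Set R3 := convexHull ℝ ({a, c, tau a, b, tau b, d} : Set R3)

/-- The support of a `W` move going through `∞`. -/
def suppWInf (a d b c : R3) : Set R3 := closure ((hexW a d b c)ᶜ)

/-- An empty `W̃` move: admissible, its support meets `L` only in `[a,d]`, and meets `𝐚`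
at most in an endpoint of `[a,d]` lying on `𝐚`. -/
def EmptyWtil (a d b c : R3) (L : PolyLink) : Prop :=
  AdmWtil a d b c L ∧
  suppWtil a d b c ∩ carrier L = segment ℝ a d ∧
  (suppWtil a d b c ∩ axisA = ∅ ∨
    (a ∈ axisA ∧ suppWtil a d b c ∩ axisA = {a}) ∨
    (d ∈ axisA ∧ suppWtil a d b c ∩ axisA = {d}))

/-- An empty `W` move (not through `∞`): admissible and its support meets `L` only in
the two consumed edges. -/
def EmptyW (a d b c : R3) (L : PolyLink) : Prop :=
  AdmW a d b c L ∧ suppW a d b c ∩ carrier L = segment ℝ a d ∪ segment ℝ d (tau a)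

/-- An empty `W` move through `∞`. -/
def EmptyWInf (a d b c : R3) (L : PolyLink) : Prop :=
  AdmWInf a d b c L ∧ suppWInf a d b c ∩ carrier L = segment ℝ a d ∪ segment ℝ d (tau a)

/-- A really empty `W̃` move. -/
def ReallyEmptyWtil (a d b c : R3) (L : PolyLink) : Prop :=
  EmptyWtil a d b c L ∧
  proj '' suppWtil a d b c ∩ proj '' carrier L = proj '' segment ℝ a d ∧
  (suppWtil a d b c ∩ axisA = ∅ ∨
    (a ∈ axisA ∧ suppWtil a d b c ∩ axisA = {a}) ∨
    (d ∈ axisA ∧ suppWtil a d b c ∩ axisA = {d}))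

/-- A really empty `W` move not going through `∞`. -/
def ReallyEmptyW (a d b c : R3) (L : PolyLink) : Prop :=
  EmptyW a d b c L ∧
  proj '' hexW a d b c ∩ proj '' carrier L
    = proj '' segment ℝ a d ∪ proj '' segment ℝ d (tau a)

/-- The quadrilateral with vertices `b`, `c`, `d`, `τ(b)`. -/
def quadInf (a d b c : R3) : Set R3 := convexHull ℝ ({b, c, d, tau b} : Set R3)

/-- A really empty `W` move going through `∞`. -/
def ReallyEmptyWInf (a d b c : R3) (L : PolyLink) : Prop :=
  EmptyWInf a d b c L ∧
  proj '' (carrier L \ (segment ℝ a d ∪ tau '' segment ℝ a d)) ∩ proj '' tri a b d = ∅ ∧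
  proj '' carrier L ⊆ proj '' quadInf a d b c

/-- A `W̃` move is of crossing type if the projections of `[a,b]` and `[d,c]` cross. -/
def CrossingType (a d b c : R3) : Prop :=
  (proj '' openSegment ℝ a b ∩ proj '' openSegment ℝ d c).Nonempty

/-- A `W` move is of type A if `π(b)` and `π(c)` lie on the same side of the projection of
the line through `a` and `τ(a)` (and `c ∉ [a,b,τ(a),τ(b)]`). -/
def TypeA (a d b c : R3) : Prop :=
  c ∉ convexHull ℝ ({a, b, tau a, tau b} : Set R3) ∧
  0 < (b.2.1 - a.2.1) * (c.2.1 - a.2.1)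

/-- A `W` move is of type B if `π(b)` and `π(c)` lie on opposite sides of the projection of
the line through `a` and `τ(a)` (and `c ∉ [a,b,τ(a),τ(b)]`). -/
def TypeB (a d b c : R3) : Prop :=
  c ∉ convexHull ℝ ({a, b, tau a, tau b} : Set R3) ∧
  (b.2.1 - a.2.1) * (c.2.1 - a.2.1) < 0

/-! ### Sawtooth moves -/

/-- The data of a sawtooth move `S̃_{p₀,…,p_m}^{q₁,…,q_m}`. -/
structure Sawtooth where
  m : ℕ
  p : Fin (m + 1) → R3
  q : Fin m → R3

/-- The edge `e = p₀ p_m` on which the sawtooth move is performed. -/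
def Sawtooth.e (S : Sawtooth) : R3 × R3 := (S.p 0, S.p (Fin.last S.m))

/-- The `i`-th tooth `[pᵢ, pᵢ₊₁, qᵢ₊₁]` of a sawtooth move. -/
def Sawtooth.tooth (S : Sawtooth) (i : Fin S.m) : Set R3 :=
  tri (S.p i.castSucc) (S.p i.succ) (S.q i)

/-- Subdivide the edge `e = p₀p_m` (and its mirror image) at the points `pᵢ` (resp. `τ(pᵢ)`);
this adds the `pᵢ` to the vertices of `L`. -/
def subdivide (m : ℕ) (p : Fin (m + 1) → R3) (L : PolyLink) : PolyLink :=
  ((L.erase (p 0, p (Fin.last m))).erase (tau (p (Fin.last m)), tau (p 0)))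
    ++ ((List.finRange m).map fun i => (p i.castSucc, p i.succ))
    ++ ((List.finRange m).map fun i => (tau (p i.succ), tau (p i.castSucc)))

/-- Apply a sequence of `Ẽ` moves. -/
def applyEtilSeq : List (R3 × R3 × R3) → PolyLink → PolyLink
  | [], L => L
  | (a, c, b) :: t, L => applyEtilSeq t (applyEtil a c b L)

/-- Each `Ẽ` move of a sequence is admissible on the link it is applied to. -/
def AdmEtilSeq : List (R3 × R3 × R3) → PolyLink → Prop
  | [], _ => True
  | (a, c, b) :: t, L => AdmEtil a c b L ∧ AdmEtilSeq t (applyEtil a c b L)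

/-- The list of `Ẽ` moves constituting a sawtooth move. -/
def Sawtooth.data (S : Sawtooth) : List (R3 × R3 × R3) :=
  (List.finRange S.m).map fun i => (S.p i.castSucc, S.p i.succ, S.q i)

/-- The result of a sawtooth move: `Ẽ_{p_{m-1},p_m}^{q_m} ∘ ⋯ ∘ Ẽ_{p₀,p₁}^{q₁}` after
subdividing the edge `e`. -/
def Sawtooth.apply (S : Sawtooth) (L : PolyLink) : PolyLink :=
  applyEtilSeq S.data (subdivide S.m S.p L)

/-- Admissibility of a sawtooth move on `L`. -/
def Sawtooth.Adm (S : Sawtooth) (L : PolyLink) : Prop :=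
  0 < S.m ∧
  S.e ∈ L ∧
  NegEdge S.e ∧
  (∀ i : Fin (S.m + 1), i ≠ 0 → i ≠ Fin.last S.m →
    S.p i ∈ openSegment ℝ (S.p 0) (S.p (Fin.last S.m))) ∧
  (∀ i : Fin S.m, NegEdge (S.p i.castSucc, S.p i.succ)) ∧
  (∀ i : Fin S.m, S.q i ∉ segment ℝ (S.p 0) (S.p (Fin.last S.m))) ∧
  (∀ i : Fin S.m, PosEdge (S.p i.castSucc, S.q i) ∧ PosEdge (S.q i, S.p i.succ)) ∧
  AdmEtilSeq S.data (subdivide S.m S.p L) ∧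
  (∀ i j : Fin S.m, i ≠ j → S.tooth i ∩ tau '' S.tooth j = ∅)

/-! ### `S³` and equivariant isotopy -/

/-- `S³` as the one-point compactification of `ℝ³`. -/
abbrev S3 := OnePoint R3

/-- The inclusion `ℝ³ ⊆ S³`. -/
def embS3 : R3 → S3 := OnePoint.some

/-- The extension of `tau` to `S³`, fixing `∞`. -/
def tauS3 : S3 → S3 := OnePoint.map tau

/-- The braid axis `𝐛 = (z-axis) ∪ {∞}` inside `S³`. -/
def axisBS3 : Set S3 := embS3 '' axisB ∪ {OnePoint.infty}

/-- Two subsets of `ℝ³` are equivariantly isotopic: there is an ambient isotopy of `S³`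
commuting with `τ` at every time and carrying the first onto the second. -/
def EquivIsotopicSets (A B : Set R3) : Prop :=
  ∃ H : ℝ → S3 ≃ₜ S3,
    Continuous (fun q : ℝ × S3 => H q.1 q.2) ∧
    H 0 = Homeomorph.refl S3 ∧
    (∀ t, ∀ x : S3, H t (tauS3 x) = tauS3 (H t x)) ∧
    H 1 '' (embS3 '' A) = embS3 '' B


/-- The involution `ρ` of `I × D²`: `(x,(y,z)) ↦ (1-x,(y,-z))`. -/
def rho : R3 → R3 := fun p => (1 - p.1, p.2.1, -p.2.2)

/-- Membership in the disk `D²`. -/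
def inDisk (u : ℝ × ℝ) : Prop := u.1 ^ 2 + u.2 ^ 2 ≤ 1

/-- The solid cylinder `I × D² ⊆ ℝ³`. -/
def Cyl : Set R3 := {p | p.1 ∈ Icc (0:ℝ) 1 ∧ inDisk (p.2.1, p.2.2)}

/-- The base points `p₁, …, p_m` on the horizontal diameter of `D²`. -/
def basePt (m : ℕ) (i : Fin m) : ℝ := -1 + 2 * ((i : ℕ) + 1) / (m + 1)

/-- A function `ℝ → ℝ²` is a PL path: affine on each interval of a finite subdivision
of `[0,1]`. -/
def IsPLPath (f : ℝ → ℝ × ℝ) : Prop :=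
  ∃ (k : ℕ) (t : Fin (k + 1) → ℝ),
    t 0 = 0 ∧ t (Fin.last k) = 1 ∧ Monotone t ∧
    ∀ j : Fin k, ∃ u v : ℝ × ℝ, ∀ s ∈ Icc (t j.castSucc) (t j.succ), f s = u + s • v

/-- A geometric braid on `m` strands in `I × D²`: each strand is (the graph of) a PL path
in the disk, strands are disjoint, start at the base points and end at a permutation
of the base points. (Parametrising strands by the `I`-coordinate makes every component
strictly monotone in the `I`-direction and excludes closed components.) -/
structure GeomBraid (m : ℕ) where
  f : Fin m → ℝ → ℝ × ℝ
  pl : ∀ i, IsPLPath (f i)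
  disj : ∀ t ∈ Icc (0:ℝ) 1, ∀ i j : Fin m, i ≠ j → f i t ≠ f j t
  inD : ∀ i, ∀ t ∈ Icc (0:ℝ) 1, inDisk (f i t)
  start : ∀ i, f i 0 = (basePt m i, 0)
  finish : ∃ σ : Equiv.Perm (Fin m), ∀ i, f i 1 = (basePt m (σ i), 0)

/-- The subset of `I × D² ⊆ ℝ³` underlying a geometric braid. -/
def GeomBraid.carrier {m : ℕ} (g : GeomBraid m) : Set R3 :=
  {p | ∃ i : Fin m, ∃ t ∈ Icc (0:ℝ) 1, p = (t, (g.f i t).1, (g.f i t).2)}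

/-- A symmetric representative: the geometric braid is fixed setwise by `ρ`. -/
def GeomBraid.Symmetric {m : ℕ} (g : GeomBraid m) : Prop := rho '' g.carrier = g.carrier

/-- Two strand families are homotopic through configurations, relative to endpoints;
this is equality in the braid group. -/
def BraidHomotopic (m : ℕ) (f g : Fin m → ℝ → ℝ × ℝ) : Prop :=
  (∀ i, f i 0 = g i 0) ∧ (∀ i, f i 1 = g i 1) ∧
  ∃ F : ℝ → Fin m → ℝ → ℝ × ℝ,
    (∀ i, ContinuousOn (fun q : ℝ × ℝ => F q.1 i q.2) (Icc 0 1 ×ˢ Icc 0 1)) ∧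
    (∀ i, ∀ t ∈ Icc (0:ℝ) 1, F 0 i t = f i t ∧ F 1 i t = g i t) ∧
    (∀ s ∈ Icc (0:ℝ) 1, ∀ i, F s i 0 = f i 0 ∧ F s i 1 = f i 1) ∧
    (∀ s ∈ Icc (0:ℝ) 1, ∀ t ∈ Icc (0:ℝ) 1, ∀ i j : Fin m, i ≠ j → F s i t ≠ F s j t) ∧
    (∀ s ∈ Icc (0:ℝ) 1, ∀ t ∈ Icc (0:ℝ) 1, ∀ i, inDisk (F s i t))

/-- Two geometric braids represent the same braid. -/
def SameBraid {m : ℕ} (a b : GeomBraid m) : Prop := BraidHomotopic m a.f b.f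

/-- `f` is piecewise linear on `s`: it agrees with affine maps on the cells of a finite
cover of `s` by compact convex sets. -/
def IsPLOn (f : R3 → R3) (s : Set R3) : Prop :=
  ∃ (k : ℕ) (P : Fin k → Set R3) (g : Fin k → (R3 →ᵃ[ℝ] R3)),
    s = ⋃ i, P i ∧ (∀ i, IsCompact (P i) ∧ Convex ℝ (P i)) ∧
    ∀ i, EqOn f (g i) (P i)

/-! ### The equivariant closure -/

/-- Embedding of `I × D²` onto the solid cylinder `B₁`. -/
def iota1 (p : R3) : R3 := (p.1 - 1/2, p.2.1 - 2, p.2.2)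

/-- Embedding of `I × D²` onto the solid cylinder `B₂`. -/
def iota2 (p : R3) : R3 := (p.1 - 1/2, p.2.1 + 2, p.2.2)

def pathSegs (l : List R3) : List (R3 × R3) := l.zip l.tail

/-- The polygonal arc through the vertices of `l`. -/
def pathCarrier (l : List R3) : Set R3 := ⋃ e ∈ pathSegs l, segment ℝ e.1 e.2

def arcStart (m : ℕ) (i : Fin m) : R3 := (-(1:ℝ)/2, basePt m i + 2, 0)
def arcEnd (m : ℕ) (i : Fin m) : R3 := (-(1:ℝ)/2, basePt m i - 2, 0)

/-- A connecting arc `γᵢ` of the equivariant closure: a polygonal arc in the `(x,y)`-plane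
from the `i`-th endpoint of `B₂` to the `i`-th endpoint of `B₁`, projecting monotonically
to the `y`-axis. -/
def IsConnArc (m : ℕ) (i : Fin m) (l : List R3) : Prop :=
  l.head? = some (arcStart m i) ∧ l.getLast? = some (arcEnd m i) ∧
  (∀ p ∈ l, p.2.2 = 0) ∧
  l.Chain' (fun p q : R3 => q.2.1 < p.2.1)

/-- `L` is an equivariant closure of the (carriers of the) geometric braids `A` and `B`:
`A` is embedded in `B₁`, `B` in `B₂`, and corresponding endpoints are joined by arcs
`γᵢ` in the `(x,y)`-plane monotone over the `y`-axis, together with their `τ`-images. -/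
def IsEqClosure (m : ℕ) (A B : Set R3) (L : Set R3) : Prop :=
  ∃ g : Fin m → List R3,
    (∀ i, IsConnArc m i (g i)) ∧
    (∀ i j, i ≠ j → pathCarrier (g i) ∩ pathCarrier (g j) = ∅) ∧
    (∀ i j, pathCarrier (g i) ∩ tau '' pathCarrier (g j) = ∅) ∧
    (∀ i, pathCarrier (g i) ∩ (iota1 '' A ∪ iota2 '' B) ⊆ {arcStart m i, arcEnd m i}) ∧
    L = iota1 '' A ∪ iota2 '' B ∪ (⋃ i, pathCarrier (g i)) ∪ (⋃ i, tau '' pathCarrier (g i))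

/-! ### The braid group and the algebraic Markov moves -/

/-- The braid relations on the Artin generators `σ₀, …, σ_{n-1}` (for the braid group on
`n+1` strands). -/
def braidRels (n : ℕ) : Set (FreeGroup (Fin n)) :=
  {r | ∃ i j : Fin n, ((i : ℕ) + 2 ≤ (j : ℕ) ∨ (j : ℕ) + 2 ≤ (i : ℕ)) ∧
      r = .of i * .of j * (.of i)⁻¹ * (.of j)⁻¹} ∪
  {r | ∃ i j : Fin n, (j : ℕ) = (i : ℕ) + 1 ∧
      r = .of i * .of j * .of i * ((.of j) * (.of i) * (.of j))⁻¹}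

/-- The braid group on `n+1` strands, with `n` Artin generators. -/
abbrev BraidGroup (n : ℕ) := PresentedGroup (braidRels n)

/-- The projection from words to braids. -/
def bmk (n : ℕ) : FreeGroup (Fin n) →* BraidGroup n := PresentedGroup.mk (braidRels n)

/-- The reverse of a word: the word read from right to left. -/
def revF {n : ℕ} : FreeGroup (Fin n) → FreeGroup (Fin n) :=
  fun w => ((FreeGroup.lift fun i => MulOpposite.op (FreeGroup.of i)) w).unop

/-- A braid is palindromic if it is represented by a word equal, in the braid group,
to its reverse. -/
def Palindromic {n : ℕ} (β : BraidGroup n) : Prop :=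
  ∃ w : FreeGroup (Fin n), bmk n w = β ∧ bmk n (revF w) = β

/-- The inclusion `S : Bₙ → Bₙ₊₁`, `σᵢ ↦ σᵢ₊₁` (at the level of words). -/
def mapS {n : ℕ} : FreeGroup (Fin n) →* FreeGroup (Fin (n + 1)) :=
  FreeGroup.lift fun i => FreeGroup.of i.succ

/-- The inclusion `E : Bₙ → Bₙ₊₁`, `σᵢ ↦ σᵢ` (at the level of words). -/
def mapE {n : ℕ} : FreeGroup (Fin n) →* FreeGroup (Fin (n + 1)) :=
  FreeGroup.lift fun i => FreeGroup.of i.castSucc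

def mapS2 {n : ℕ} : FreeGroup (Fin n) →* FreeGroup (Fin (n + 2)) := mapS.comp mapS

/-- The letter `σᵢ^{±1}`. -/
def genW {n : ℕ} (p : Fin n × Bool) : FreeGroup (Fin n) :=
  cond p.2 (FreeGroup.of p.1) (FreeGroup.of p.1)⁻¹

/-- The word `Δ = σ_{j₁}^{ε₁} ⋯ σ_{j_k}^{ε_k}`. -/
def deltaWord {n : ℕ} (d : List (Fin n × Bool)) : FreeGroup (Fin n) := (d.map genW).prod

/-- `Δ` is a product of distinct pairwise-commuting Artin generators. -/
def IsDelta {n : ℕ} (d : List (Fin n × Bool)) : Prop :=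
  d.Pairwise fun p q => (p.1 : ℕ) + 2 ≤ (q.1 : ℕ) ∨ (q.1 : ℕ) + 2 ≤ (p.1 : ℕ)

/-- The bottom generator `σ₁^{±1}` of `B_{n+2}`. -/
def sigmaBot (n : ℕ) (ε : Bool) : FreeGroup (Fin (n + 1)) := genW (⟨0, n.succ_pos⟩, ε)

/-- The top generator `σ_{n+1}^{±1}` of `B_{n+2}`. -/
def sigmaTop (n : ℕ) (ε : Bool) : FreeGroup (Fin (n + 1)) := genW (Fin.last n, ε)

def sigma2 (n : ℕ) (ε : Bool) : FreeGroup (Fin (n + 2)) :=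
  genW (⟨1, by omega⟩, ε)

def sigma1' (n : ℕ) (ε : Bool) : FreeGroup (Fin (n + 2)) :=
  genW (⟨0, by omega⟩, ε)

/-- A state: a pair of (palindromic) braids on a common number of strands. -/
abbrev MPair := Σ n : ℕ, BraidGroup n × BraidGroup n

/-- Equivariant conjugation: `(α, β) ↦ (γ α γ̄, γ̄⁻¹ β γ⁻¹)`. -/
def ConjStep (P Q : MPair) : Prop :=
  ∃ (n : ℕ) (α β : BraidGroup n) (g : FreeGroup (Fin n)),
    P = ⟨n, (α, β)⟩ ∧
    Q = ⟨n, (bmk n g * α * bmk n (revF g), (bmk n (revF g))⁻¹ * β * (bmk n g)⁻¹)⟩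

/-- Stabilization of type `S` on a fixed point. -/
def StabSStep (P Q : MPair) : Prop :=
  ∃ (n : ℕ) (x w : FreeGroup (Fin n)) (d : List (Fin n × Bool)) (ε : Bool),
    IsDelta d ∧ (∀ p ∈ d, (p.1 : ℕ) ≠ 0) ∧
    ((P = ⟨n, (bmk n (x * deltaWord d * revF x), bmk n w)⟩ ∧
      Q = ⟨n + 1, (bmk (n + 1) (mapS x * mapS (deltaWord d) * sigmaBot n ε * mapS (revF x)),
        bmk (n + 1) (mapS w))⟩) ∨
     (P = ⟨n, (bmk n w, bmk n (x * deltaWord d * revF x))⟩ ∧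
      Q = ⟨n + 1, (bmk (n + 1) (mapS w),
        bmk (n + 1) (mapS x * mapS (deltaWord d) * sigmaBot n ε * mapS (revF x)))⟩))

/-- Stabilization of type `E` on a fixed point. -/
def StabEStep (P Q : MPair) : Prop :=
  ∃ (n : ℕ) (x w : FreeGroup (Fin n)) (d : List (Fin n × Bool)) (ε : Bool),
    IsDelta d ∧ (∀ p ∈ d, (p.1 : ℕ) + 1 ≠ n) ∧
    ((P = ⟨n, (bmk n (x * deltaWord d * revF x), bmk n w)⟩ ∧
      Q = ⟨n + 1, (bmk (n + 1) (mapE x * mapE (deltaWord d) * sigmaTop n ε * mapE (revF x)),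
        bmk (n + 1) (mapE w))⟩) ∨
     (P = ⟨n, (bmk n w, bmk n (x * deltaWord d * revF x))⟩ ∧
      Q = ⟨n + 1, (bmk (n + 1) (mapE w),
        bmk (n + 1) (mapE x * mapE (deltaWord d) * sigmaTop n ε * mapE (revF x)))⟩))

/-- Double stabilization. -/
def DoubleStep (P Q : MPair) : Prop :=
  ∃ (n : ℕ) (x y : FreeGroup (Fin n)) (d d' : List (Fin n × Bool)) (ε η : Bool),
    IsDelta d ∧ IsDelta d' ∧
    P = ⟨n, (bmk n (x * deltaWord d * revF x), bmk n (y * deltaWord d' * revF y))⟩ ∧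
    Q = ⟨n + 2, (bmk (n + 2) (mapS2 x * mapS2 (deltaWord d) * sigma1' n ε * mapS2 (revF x)),
      bmk (n + 2) (sigma2 n η * mapS2 y * mapS2 (deltaWord d') * sigma1' n (!ε) *
        mapS2 (revF y) * sigma2 n η))⟩

/-- One equivariant Markov move: equivariant conjugation, (de-)stabilization of type `S`
or `E` on a fixed point, or double stabilization. -/
def MarkovRel (P Q : MPair) : Prop :=
  ConjStep P Q ∨ ConjStep Q P ∨ StabSStep P Q ∨ StabSStep Q P ∨
  StabEStep P Q ∨ StabEStep Q P ∨ DoubleStep P Q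

/-! ### Geometric realization of words -/

/-- The motion of the `n+1` base points realizing one letter `σ_k^{±1}`. -/
def letterMotion (n : ℕ) (k : Fin n) (ε : Bool) (i : Fin (n + 1)) (t : ℝ) : ℝ × ℝ :=
  let c : ℝ := (basePt (n + 1) k.castSucc + basePt (n + 1) k.succ) / 2
  let r : ℝ := (basePt (n + 1) k.succ - basePt (n + 1) k.castSucc) / 2
  let s : ℝ := cond ε 1 (-1)
  if i = k.castSucc then (c - r * Real.cos (Real.pi * t), s * r * Real.sin (Real.pi * t))
  else if i = k.succ then (c + r * Real.cos (Real.pi * t), -s * r * Real.sin (Real.pi * t))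
  else (basePt (n + 1) i, 0)

/-- The strand paths realizing a word, parametrized on `[0, length]`. -/
def wordPathN (n : ℕ) : List (Fin n × Bool) → Fin (n + 1) → ℝ → ℝ × ℝ
  | [], i, _ => (basePt (n + 1) i, 0)
  | ℓ :: rest, i, t =>
      if t ≤ 1 then letterMotion n ℓ.1 ℓ.2 i t
      else wordPathN n rest (Equiv.swap ℓ.1.castSucc ℓ.1.succ i) (t - 1)

/-- The standard geometric realization of a word, parametrized on `[0,1]`. -/
def wordPath (n : ℕ) (w : List (Fin n × Bool)) (i : Fin (n + 1)) (t : ℝ) : ℝ × ℝ :=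
  wordPathN n w i (t * w.length)

/-- A geometric braid represents an element of the braid group if it is braid-homotopic
to the standard realization of some word for that element. -/
def Represents {n : ℕ} (g : GeomBraid (n + 1)) (β : BraidGroup n) : Prop :=
  ∃ w : FreeGroup (Fin n), bmk n w = β ∧
    BraidHomotopic (n + 1) g.f (wordPath n w.toWord)


/-- A single-tooth sawtooth move `S̃_{a,d}^b`: the negative edge `[a,d]` is replaced
equivariantly by the positive edges `[a,b] ∪ [b,d]`. -/
def AdmSingleSaw (a d b : R3) (L : PolyLink) : Prop :=
  (a, d) ∈ L ∧ NegEdge (a, d) ∧ PosEdge (a, b) ∧ PosEdge (b, d) ∧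
  b ∉ segment ℝ a d ∧ AdmEtil a d b L

/-- An admissible `R̃` move, as a step relation on links. -/
def RtilStep (X Y : PolyLink) : Prop :=
  ∃ a c b, AdmRtil a c b X ∧ Y = applyEtil a c b X

/-- An admissible `W̃` move, as a step relation on links. -/
def AdmWtilStep (X Y : PolyLink) : Prop :=
  ∃ a d b c, AdmWtil a d b c X ∧ Y = applyWtil a d b c X

/-! ### The involution and triangles -/

/-- `tau` as a linear map. -/
def tauLin : R3 →ₗ[ℝ] R3 where
  toFun := tau
  map_add' p q := by simp only [tau, Prod.fst_add, Prod.snd_add, Prod.mk_add_mk, neg_add]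
  map_smul' r p := by simp [tau]

@[simp] lemma tau_tau (p : R3) : tau (tau p) = p := by simp [tau]

lemma tau_injective : Function.Injective tau := Function.LeftInverse.injective tau_tau

lemma continuous_tau : Continuous tau := by unfold tau; fun_prop

@[simp] lemma tau_image_image (s : Set R3) : tau '' (tau '' s) = s := by
  simp [Set.image_image]

lemma mem_tau_image {s : Set R3} {p : R3} : p ∈ tau '' s ↔ tau p ∈ s :=
  ⟨fun ⟨q, hq, h⟩ => by rw [← h, tau_tau]; exact hq, fun h => ⟨tau p, h, tau_tau p⟩⟩

lemma tau_image_tri (p q r : R3) : tau '' tri p q r = tri (tau p) (tau q) (tau r) := by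
  have h := LinearMap.image_convexHull tauLin ({p, q, r} : Set R3)
  simp only [Set.image_insert_eq, Set.image_singleton] at h
  exact h

lemma tau_image_segment (p q : R3) : tau '' segment ℝ p q = segment ℝ (tau p) (tau q) := by
  have h := LinearMap.image_convexHull tauLin ({p, q} : Set R3)
  simp only [Set.image_insert_eq, Set.image_singleton, convexHull_pair] at h
  exact h

/-- The mirror image of an oriented edge, with the orientation reversed. -/
def mir (e : R3 × R3) : R3 × R3 := (tau e.2, tau e.1)

@[simp] lemma mir_mk (p q : R3) : mir (p, q) = (tau q, tau p) := rfl

@[simp] lemma mir_mir (e : R3 × R3) : mir (mir e) = e := by simp [mir]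

lemma mir_injective : Function.Injective mir := Function.LeftInverse.injective mir_mir

lemma segment_mir (e : R3 × R3) :
    segment ℝ (mir e).1 (mir e).2 = tau '' segment ℝ e.1 e.2 := by
  rw [tau_image_segment, segment_symm]; rfl

lemma mem_tri_iff {p a b c : R3} : p ∈ tri a b c ↔
    ∃ u v w : ℝ, 0 ≤ u ∧ 0 ≤ v ∧ 0 ≤ w ∧ u + v + w = 1 ∧ p = u • a + v • b + w • c := by
  constructor
  · intro hp
    rw [tri, convexHull_insert (by simp), convexHull_pair, mem_convexJoin] at hp
    obtain ⟨_, rfl, q, ⟨s, t, hs, ht, hst, rfl⟩, ⟨u, v, hu, hv, huv, rfl⟩⟩ := hp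
    refine ⟨u, v * s, v * t, hu, by positivity, by positivity, ?_, ?_⟩
    · rw [add_assoc, ← mul_add, hst, mul_one, huv]
    · simp [smul_add, smul_smul, add_assoc]
  · rintro ⟨u, v, w, hu, hv, hw, h, rfl⟩
    have hc := convex_convexHull ℝ ({a, b, c} : Set R3)
    have ha : a ∈ tri a b c := subset_convexHull _ _ (by simp)
    have hb : b ∈ tri a b c := subset_convexHull _ _ (by simp)
    have hcc : c ∈ tri a b c := subset_convexHull _ _ (by simp)
    have := hc.sum_mem (t := Finset.univ) (w := ![u, v, w]) (z := ![a, b, c])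
      (by intro i _; fin_cases i <;> simpa) (by simp [Fin.sum_univ_three, h])
      (by intro i _; fin_cases i <;> simpa [tri] using by assumption)
    simpa [tri, Fin.sum_univ_three] using this

lemma convex_tri (a b c : R3) : Convex ℝ (tri a b c) := convex_convexHull _ _

lemma isCompact_tri (a b c : R3) : IsCompact (tri a b c) :=
  (Set.toFinite ({a, b, c} : Set R3)).isCompact_convexHull ℝ

lemma left_mem_tri (a b c : R3) : a ∈ tri a b c := subset_convexHull _ _ (by simp)

lemma mid_mem_tri (a b c : R3) : b ∈ tri a b c := subset_convexHull _ _ (by simp)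

lemma right_mem_tri (a b c : R3) : c ∈ tri a b c := subset_convexHull _ _ (by simp)

lemma tri_subset {S : Set R3} (hS : Convex ℝ S) {a b c : R3} (ha : a ∈ S) (hb : b ∈ S)
    (hc : c ∈ S) : tri a b c ⊆ S :=
  convexHull_min (by rintro _ (rfl | rfl | rfl) <;> assumption) hS

lemma tri_rev (a b c : R3) : tri a b c = tri c b a := by
  unfold tri; congr 1; ext; simp; tauto

lemma tri_rotate (a b c : R3) : tri a b c = tri b c a := by
  unfold tri; congr 1; ext; simp; tauto

lemma tri_left_left (a b : R3) : tri a a b = segment ℝ a b := by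
  simp [tri, convexHull_pair]

lemma tri_right_right (a b : R3) : tri a b b = segment ℝ a b := by
  simp [tri, convexHull_pair]

lemma tri_outer_eq (a b : R3) : tri a b a = segment ℝ a b := by
  rw [tri_rotate, tri_rotate, tri_left_left]

lemma segment_left_subset_tri (a b c : R3) : segment ℝ a b ⊆ tri a b c :=
  (convex_tri a b c).segment_subset (left_mem_tri _ _ _) (mid_mem_tri _ _ _)

lemma segment_right_subset_tri (a b c : R3) : segment ℝ b c ⊆ tri a b c :=
  (convex_tri a b c).segment_subset (mid_mem_tri _ _ _) (right_mem_tri _ _ _)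

lemma segment_outer_subset_tri (a b c : R3) : segment ℝ a c ⊆ tri a b c :=
  (convex_tri a b c).segment_subset (left_mem_tri _ _ _) (right_mem_tri _ _ _)

/-- A triangle and a segment on the two sides of a plane meet at most in the endpoint of the
segment lying on the plane. -/
lemma tri_inter_segment_subset (f : R3 →ₗ[ℝ] ℝ) {k : ℝ} {a b c u v : R3}
    (ha : f a ≤ k) (hb : f b ≤ k) (hc : f c ≤ k) (hu : f u = k) (hv : k < f v) :
    tri a b c ∩ segment ℝ u v ⊆ {u} := by
  rintro p ⟨hp, s, t, hs, ht, hst, rfl⟩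
  obtain ⟨x, y, z, hx, hy, hz, hxyz, h⟩ := mem_tri_iff.1 hp
  have h1 := congrArg f h
  simp only [map_add, map_smul, smul_eq_mul] at h1
  have ht0 : t = 0 := by
    by_contra hne
    have : 0 < t := lt_of_le_of_ne ht (Ne.symm hne)
    have h2 : k = x * k + y * k + z * k := by linear_combination (-k) * hxyz
    have h3 : k = s * k + t * k := by linear_combination (-k) * hst
    rw [hu] at h1
    linarith [mul_le_mul_of_nonneg_left ha hx, mul_le_mul_of_nonneg_left hb hy,
      mul_le_mul_of_nonneg_left hc hz, mul_lt_mul_of_pos_left hv this]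
  have hs1 : s = 1 := by linarith
  simp [ht0, hs1]

lemma notMem_tri_of_lt (f : R3 →ₗ[ℝ] ℝ) {k : ℝ} {a b c p : R3}
    (ha : f a ≤ k) (hb : f b ≤ k) (hc : f c ≤ k) (hp : k < f p) : p ∉ tri a b c := by
  intro h
  obtain ⟨x, y, z, hx, hy, hz, hxyz, rfl⟩ := mem_tri_iff.1 h
  simp only [map_add, map_smul, smul_eq_mul] at hp
  have h2 : k = x * k + y * k + z * k := by linear_combination (-k) * hxyz
  linarith [mul_le_mul_of_nonneg_left ha hx, mul_le_mul_of_nonneg_left hb hy,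
    mul_le_mul_of_nonneg_left hc hz]

/-- Twice the signed area of the projection of the triangle `p`, `q`, `r`. -/
def area (p q r : R3) : ℝ := cross2 (proj q - proj p) (proj r - proj p)

lemma area_eq (p q r : R3) : area p q r =
    cross2 (proj p) (proj q) + cross2 (proj q) (proj r) + cross2 (proj r) (proj p) := by
  simp [area, cross2, proj]; ring

lemma posEdge_mir {p q : R3} : PosEdge (tau q, tau p) ↔ PosEdge (p, q) := by
  have : cross2 (proj (tau q)) (proj (tau p)) = cross2 (proj p) (proj q) := by
    simp [cross2, proj, tau]; ring
  simp only [PosEdge, this]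

/-- The functional `p ↦ w × π(p)`. -/
def crossLin (w : ℝ × ℝ) : R3 →ₗ[ℝ] ℝ where
  toFun p := cross2 w (proj p)
  map_add' p q := by simp [cross2, proj]; ring
  map_smul' r p := by simp [cross2, proj]; ring

lemma crossLin_apply (w : ℝ × ℝ) (p : R3) : crossLin w p = cross2 w (proj p) := rfl

lemma ne_of_area {p q r : R3} (h : area p q r ≠ 0) : p ≠ q ∧ p ≠ r ∧ q ≠ r := by
  refine ⟨?_, ?_, ?_⟩ <;> rintro rfl <;> apply h <;> simp [area, cross2] <;> ring

lemma segment_inter_of_area {p q r : R3} (h : area p q r ≠ 0) :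
    segment ℝ p q ∩ segment ℝ p r ⊆ {p} := by
  rintro _ ⟨⟨s, t, hs, ht, hst, rfl⟩, ⟨s', t', hs', ht', hst', h'⟩⟩
  have hs1 : s = 1 - t := by linarith
  have hs2 : s' = 1 - t' := by linarith
  subst hs1 hs2
  have h1 := congrArg (fun x : R3 => x.1) h'
  have h2 := congrArg (fun x : R3 => x.2.1) h'
  simp at h1 h2
  have ht0 : t * area p q r = 0 := by
    simp only [area, cross2, proj, Prod.fst_sub, Prod.snd_sub]
    linear_combination (-(r.2.1 - p.2.1)) * h1 + (r.1 - p.1) * h2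
  have : t = 0 := by simpa [h] using ht0
  simp [this]

/-! ### Edge lists -/

lemma isLink_iff {L : PolyLink} : IsLink L ↔ L.Nodup ∧ (∀ e ∈ L, e.1 ≠ e.2) ∧
    (∀ e ∈ L, ∀ f ∈ L, e ≠ f →
      segment ℝ e.1 e.2 ∩ segment ℝ f.1 f.2 ⊆ ({e.1, e.2} : Set R3) ∩ ({f.1, f.2} : Set R3)) ∧
    (∀ e ∈ L, ∃ f ∈ L, f.1 = e.2) ∧ (∀ e ∈ L, ∃ f ∈ L, f.2 = e.1) ∧
    (∀ e ∈ L, ∀ f ∈ L, e.1 = f.1 → e = f) ∧ (∀ e ∈ L, ∀ f ∈ L, e.2 = f.2 → e = f) := by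
  constructor
  · rintro ⟨h1, h2, h3, h4, h5⟩
    refine ⟨h1, h2, h3, fun e he => (h4 e he).exists.imp fun _ h => h,
      fun e he => (h5 e he).exists.imp fun _ h => h, fun e he f hf hef => ?_,
      fun e he f hf hef => ?_⟩
    · obtain ⟨g, hg, hge⟩ := (h5 e he).exists
      exact (h4 g hg).unique ⟨he, hge.symm⟩ ⟨hf, by rw [← hef, hge]⟩
    · obtain ⟨g, hg, hge⟩ := (h4 e he).exists
      exact (h5 g hg).unique ⟨he, hge.symm⟩ ⟨hf, by rw [← hef, hge]⟩
  · rintro ⟨h1, h2, h3, h4, h5, h6, h7⟩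
    refine ⟨h1, h2, h3, fun e he => ?_, fun e he => ?_⟩
    · obtain ⟨f, hf, hfe⟩ := h4 e he
      exact ⟨f, ⟨hf, hfe⟩, fun g hg => h6 g hg.1 f hf (by rw [hg.2, hfe])⟩
    · obtain ⟨f, hf, hfe⟩ := h5 e he
      exact ⟨f, ⟨hf, hfe⟩, fun g hg => h7 g hg.1 f hf (by rw [hg.2, hfe])⟩

lemma IsLink.perm {L L' : PolyLink} (h : IsLink L) (hp : L.Perm L') : IsLink L' := by
  have hm : ∀ e, e ∈ L' ↔ e ∈ L := fun e => hp.mem_iff.symm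
  obtain ⟨h1, h2⟩ := h
  refine ⟨hp.nodup_iff.1 h1, ?_⟩
  simpa only [hm] using h2

lemma mem_carrier {L : PolyLink} {p : R3} :
    p ∈ carrier L ↔ ∃ e ∈ L, p ∈ segment ℝ e.1 e.2 := by
  simp [carrier]

lemma segment_subset_carrier {L : PolyLink} {e : R3 × R3} (he : e ∈ L) :
    segment ℝ e.1 e.2 ⊆ carrier L := fun _ hp => mem_carrier.2 ⟨e, he, hp⟩

lemma right_notMem_segment_of_area {p q r : R3} (h : area p r q ≠ 0) : q ∉ segment ℝ p r := by
  intro hq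
  have := segment_inter_of_area h ⟨hq, right_mem_segment ℝ p q⟩
  exact (ne_of_area h).2.1 this.symm

/-- The triangle move `E_{p,q}^r` is admissible as soon as the triangle meets the other edges
in endpoints of the edge `(p, q)` only. -/
lemma admE_of_clear {X : PolyLink} (hX : IsLink X) {p q r : R3} (hpq : (p, q) ∈ X)
    (hA : area p r q ≠ 0)
    (hclear : ∀ f ∈ X, f ≠ (p, q) → tri p r q ∩ segment ℝ f.1 f.2 ⊆ {p, q}) :
    AdmE p q r X := by
  obtain ⟨hpr, hpq', hrq⟩ := ne_of_area hA
  have hA' : area q r p ≠ 0 := by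
    have : area q r p = - area p r q := by simp only [area_eq, cross2]; ring
    rw [this]; exact neg_ne_zero.2 hA
  obtain ⟨h1, h2, h3, h4, h5, h6, h7⟩ := isLink_iff.1 hX
  have hmem : ∀ f, f ∈ X.erase (p, q) ↔ f ∈ X ∧ f ≠ (p, q) := fun f => by
    rw [h1.mem_erase_iff]; tauto
  have hr : ∀ f ∈ X, r ∉ segment ℝ f.1 f.2 := by
    intro f hf hrf
    by_cases hfe : f = (p, q)
    · subst hfe
      have hA2 : area p q r ≠ 0 := by
        have : area p q r = - area p r q := by simp only [area_eq, cross2]; ring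
        rw [this]; exact neg_ne_zero.2 hA
      exact right_notMem_segment_of_area hA2 hrf
    · rcases hclear f hf hfe ⟨mid_mem_tri _ _ _, hrf⟩ with h | h
      · exact hpr h.symm
      · exact hrq h
  have hr1 : ∀ f ∈ X, f.1 ≠ r := fun f hf h => hr f hf (h ▸ left_mem_segment ℝ _ _)
  have hr2 : ∀ f ∈ X, f.2 ≠ r := fun f hf h => hr f hf (h ▸ right_mem_segment ℝ _ _)
  have hnew1 : ∀ f ∈ X, f ≠ (p, q) →
      segment ℝ f.1 f.2 ∩ segment ℝ p r ⊆ ({f.1, f.2} : Set R3) ∩ {p, r} := by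
    rintro f hf hfe y ⟨hy1, hy2⟩
    rcases hclear f hf hfe ⟨segment_left_subset_tri _ _ _ hy2, hy1⟩ with rfl | hy
    · exact ⟨(h3 f hf _ hpq hfe ⟨hy1, left_mem_segment ℝ _ _⟩).1, Or.inl rfl⟩
    · rw [Set.mem_singleton_iff] at hy
      subst hy; exact absurd hy2 (right_notMem_segment_of_area hA)
  have hnew2 : ∀ f ∈ X, f ≠ (p, q) →
      segment ℝ f.1 f.2 ∩ segment ℝ r q ⊆ ({f.1, f.2} : Set R3) ∩ {r, q} := by
    rintro f hf hfe y ⟨hy1, hy2⟩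
    rcases hclear f hf hfe ⟨segment_right_subset_tri _ _ _ hy2, hy1⟩ with rfl | hy
    · exact absurd (segment_symm ℝ r q ▸ hy2) (right_notMem_segment_of_area hA')
    · rw [Set.mem_singleton_iff] at hy
      subst hy
      exact ⟨(h3 f hf _ hpq hfe ⟨hy1, right_mem_segment ℝ _ _⟩).1, Or.inr rfl⟩
  have hnew3 : segment ℝ p r ∩ segment ℝ r q ⊆ ({p, r} : Set R3) ∩ {r, q} := by
    have := segment_inter_of_area (p := r) (q := p) (r := q) (by
      have : area r p q = - area p r q := by simp only [area_eq, cross2]; ring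
      rw [this]; exact neg_ne_zero.2 hA)
    rw [segment_symm ℝ p r]
    intro y hy
    have := this hy
    rw [Set.mem_singleton_iff] at this
    subst this; simp
  refine ⟨⟨hpq, isLink_iff.2 ⟨?_, ?_, ?_, ?_, ?_, ?_, ?_⟩⟩, ?_⟩
  · rw [applyE, List.nodup_append]
    refine ⟨h1.erase _, ?_, ?_⟩
    · simp [hpr]
    · rintro f hf g hg rfl
      rw [hmem] at hf
      simp only [List.mem_cons, List.not_mem_nil, or_false] at hg
      rcases hg with rfl | rfl
      · exact hr2 _ hf.1 rfl
      · exact hr1 _ hf.1 rfl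
  · intro e he
    simp only [applyE, List.mem_append, hmem, List.mem_cons, List.not_mem_nil, or_false] at he
    rcases he with he | rfl | rfl
    exacts [h2 e he.1, hpr, hrq]
  · intro e he f hf hef
    simp only [applyE, List.mem_append, hmem, List.mem_cons, List.not_mem_nil, or_false] at he hf
    rcases he with he | rfl | rfl <;> rcases hf with hf | rfl | rfl
    · exact h3 e he.1 f hf.1 hef
    · exact hnew1 e he.1 he.2
    · exact hnew2 e he.1 he.2
    · rw [Set.inter_comm, Set.inter_comm {_, _}]; exact hnew1 f hf.1 hf.2
    · exact absurd rfl hef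
    · exact hnew3
    · rw [Set.inter_comm, Set.inter_comm {_, _}]; exact hnew2 f hf.1 hf.2
    · rw [Set.inter_comm, Set.inter_comm {_, _}]; exact hnew3
    · exact absurd rfl hef
  · intro e he
    simp only [applyE, List.mem_append, hmem, List.mem_cons, List.not_mem_nil, or_false] at he ⊢
    rcases he with he | rfl | rfl
    · obtain ⟨f, hf, hfe⟩ := h4 e he.1
      by_cases h : f = (p, q)
      · exact ⟨(p, r), Or.inr (Or.inl rfl), by rw [← hfe, h]⟩
      · exact ⟨f, Or.inl ⟨hf, h⟩, hfe⟩
    · exact ⟨(r, q), by simp, rfl⟩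
    · obtain ⟨f, hf, hfe⟩ := h4 _ hpq
      exact ⟨f, Or.inl ⟨hf, by rintro rfl; exact hpq' hfe⟩, hfe⟩
  · intro e he
    simp only [applyE, List.mem_append, hmem, List.mem_cons, List.not_mem_nil, or_false] at he ⊢
    rcases he with he | rfl | rfl
    · obtain ⟨f, hf, hfe⟩ := h5 e he.1
      by_cases h : f = (p, q)
      · exact ⟨(r, q), Or.inr (Or.inr rfl), by rw [← hfe, h]⟩
      · exact ⟨f, Or.inl ⟨hf, h⟩, hfe⟩
    · obtain ⟨f, hf, hfe⟩ := h5 _ hpq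
      exact ⟨f, Or.inl ⟨hf, by rintro rfl; exact hpq' hfe.symm⟩, hfe⟩
    · exact ⟨(p, r), by simp, rfl⟩
  · intro e he f hf hef
    simp only [applyE, List.mem_append, hmem, List.mem_cons, List.not_mem_nil, or_false] at he hf
    rcases he with he | rfl | rfl <;> rcases hf with hf | rfl | rfl
    · exact h6 e he.1 f hf.1 hef
    · exact absurd (h6 e he.1 _ hpq hef) he.2
    · exact absurd hef (hr1 e he.1)
    · exact absurd (h6 f hf.1 _ hpq hef.symm) hf.2
    · rfl
    · exact absurd hef hpr
    · exact absurd hef.symm (hr1 f hf.1)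
    · exact absurd hef.symm hpr
    · rfl
  · intro e he f hf hef
    simp only [applyE, List.mem_append, hmem, List.mem_cons, List.not_mem_nil, or_false] at he hf
    rcases he with he | rfl | rfl <;> rcases hf with hf | rfl | rfl
    · exact h7 e he.1 f hf.1 hef
    · exact absurd hef (hr2 e he.1)
    · exact absurd (h7 e he.1 _ hpq hef) he.2
    · exact absurd hef.symm (hr2 f hf.1)
    · rfl
    · exact absurd hef hrq
    · exact absurd (h7 f hf.1 _ hpq hef.symm) hf.2
    · exact absurd hef.symm hrq
    · rfl
  · refine Set.Subset.antisymm ?_ fun y hy =>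
      ⟨segment_outer_subset_tri _ _ _ hy, segment_subset_carrier hpq hy⟩
    rintro y ⟨hy1, hy2⟩
    obtain ⟨f, hf, hyf⟩ := mem_carrier.1 hy2
    by_cases h : f = (p, q)
    · subst h; exact hyf
    · rcases hclear f hf h ⟨hy1, hyf⟩ with rfl | h
      · exact left_mem_segment ℝ _ _
      · rw [Set.mem_singleton_iff] at h; subst h; exact right_mem_segment ℝ _ _

/-- Conversely, the triangle of an admissible move meets the other edges in endpoints of the
edge `(p, q)` only. -/
lemma AdmE.clear {X : PolyLink} (hX : IsLink X) {p q r : R3} (h : AdmE p q r X)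
    {f : R3 × R3} (hf : f ∈ X) (hne : f ≠ (p, q)) :
    tri p r q ∩ segment ℝ f.1 f.2 ⊆ {p, q} := by
  rintro y ⟨hy1, hy2⟩
  have hy : y ∈ segment ℝ p q := h.2 ▸ ⟨hy1, segment_subset_carrier hf hy2⟩
  exact (hX.2.2.1 f hf _ h.1.1 hne ⟨hy2, hy⟩).2

/-! ### Equivariant moves inside a region -/

/-- The edge list made of `N`, the edges of `T` and their mirror images. -/
def sym (N T : PolyLink) : PolyLink := N ++ (T ++ T.map mir)

lemma sym_perm {N T T' : PolyLink} (h : T.Perm T') : (sym N T).Perm (sym N T') :=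
  (h.append (h.map mir)).append_left N

lemma mem_sym {N T : PolyLink} {f : R3 × R3} :
    f ∈ sym N T ↔ f ∈ N ∨ f ∈ T ∨ ∃ g ∈ T, mir g = f := by
  simp [sym]

/-- The region `Ω` and its mirror image meet the edges of `N`, and each other, only in `V`
and in the mirror image of `V`. -/
structure Arena (N : PolyLink) (V Ω : Set R3) : Prop where
  inter : Ω ∩ carrier N ⊆ V
  inter_mir : tau '' Ω ∩ carrier N ⊆ tau '' V
  cross : Ω ∩ tau '' Ω ⊆ V ∩ tau '' V

lemma Arena.symm {N : PolyLink} {V Ω : Set R3} (h : Arena N V Ω) :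
    Arena N (tau '' V) (tau '' Ω) where
  inter := h.inter_mir
  inter_mir := by simpa using h.inter
  cross := by simpa [Set.inter_comm] using h.cross

lemma tri_tau (p r q : R3) : tri (tau q) (tau r) (tau p) = tau '' tri p r q := by
  rw [tau_image_tri, tri_rev]

/-- An equivariant triangle move inside a region whose triangle avoids the other edges inside
the region is admissible. -/
lemma Arena.admEtil {N T X : PolyLink} {V Ω : Set R3} (hΩ : Arena N V Ω) {p q r : R3}
    (hX : X.Perm (sym N ((p, q) :: T))) (hL : IsLink X)
    (hA : area p r q ≠ 0) (hT : ∀ f ∈ T, segment ℝ f.1 f.2 ⊆ Ω) (htri : tri p r q ⊆ Ω)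
    (hV : tri p r q ∩ V ⊆ {p, q})
    (hclear : ∀ f ∈ T, tri p r q ∩ segment ℝ f.1 f.2 ⊆ {p, q}) :
    AdmEtil p q r X ∧ (applyEtil p q r X).Perm (sym N ((p, r) :: (r, q) :: T)) ∧
      IsLink (applyEtil p q r X) := by
  have hpq : segment ℝ p q ⊆ Ω := (segment_outer_subset_tri p r q).trans htri
  have hmem : (p, q) ∈ X := hX.mem_iff.2 (mem_sym.2 (by simp))
  have hseg : ∀ g ∈ (p, q) :: T, segment ℝ g.1 g.2 ⊆ Ω := by
    intro g hg
    rcases List.mem_cons.1 hg with rfl | hg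
    exacts [hpq, hT g hg]
  have h1 : AdmE p q r X := by
    refine admE_of_clear hL hmem hA fun f hf hne => ?_
    rcases mem_sym.1 (hX.mem_iff.1 hf) with h | h | ⟨g, hg, rfl⟩
    · exact fun y hy => hV ⟨hy.1, hΩ.inter ⟨htri hy.1, segment_subset_carrier h hy.2⟩⟩
    · exact hclear f ((List.mem_cons.1 h).resolve_left hne)
    · rw [segment_mir]
      exact fun y hy => hV ⟨hy.1, (hΩ.cross ⟨htri hy.1, Set.image_mono (hseg g hg) hy.2⟩).1⟩
  have hX1 : (applyE p q r X).Perm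
      (mir (p, q) :: (N ++ (T ++ ([(p, r), (r, q)] ++ T.map mir)))) := by
    have h2 : X.Perm ((p, q) :: mir (p, q) :: (N ++ (T ++ T.map mir))) := by
      refine hX.trans ?_
      simp only [sym, List.map_cons, List.cons_append]
      refine List.perm_middle.trans (List.Perm.cons _ ?_)
      refine (List.Perm.append_left N List.perm_middle).trans List.perm_middle
    have h3 := h2.erase (p, q)
    rw [List.erase_cons_head] at h3
    refine (h3.append_right [(p, r), (r, q)]).trans ?_
    rw [List.cons_append, List.append_assoc, List.append_assoc]
    exact List.Perm.cons _ (((List.perm_append_comm).append_left T).append_left N)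
  have h2 : AdmE (tau q) (tau p) (tau r) (applyE p q r X) := by
    refine admE_of_clear h1.1.2 (hX1.mem_iff.2 (by simp)) ?_ fun f hf hne => ?_
    · have : area (tau q) (tau r) (tau p) = area p r q := by
        simp [area, cross2, proj, tau]; ring
      rwa [this]
    have hcl : ∀ S : Set R3, tri p r q ∩ S ⊆ {p, q} → tau '' tri p r q ∩ tau '' S ⊆
        {tau q, tau p} := by
      intro S hS
      rw [← Set.image_inter tau_injective]
      refine (Set.image_mono hS).trans ?_
      rw [Set.image_pair, Set.pair_comm]
    rw [tri_tau]
    have hf := (List.mem_cons.1 (hX1.mem_iff.1 hf)).resolve_left hne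
    simp only [List.mem_append, List.mem_cons, List.not_mem_nil, or_false, List.mem_map] at hf
    have hin : segment ℝ f.1 f.2 ⊆ Ω → tau '' tri p r q ∩ segment ℝ f.1 f.2 ⊆
        {tau q, tau p} := fun hs y hy => hcl V hV
        ⟨hy.1, (hΩ.cross ⟨hs hy.2, Set.image_mono htri hy.1⟩).2⟩
    rcases hf with h | h | (rfl | rfl) | ⟨g, hg, rfl⟩
    · exact fun y hy => hcl V hV ⟨hy.1, hΩ.inter_mir
        ⟨Set.image_mono htri hy.1, segment_subset_carrier h hy.2⟩⟩
    · exact hin (hT f h)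
    · exact hin ((segment_left_subset_tri p r q).trans htri)
    · exact hin ((segment_right_subset_tri p r q).trans htri)
    · rw [segment_mir]; exact hcl _ (hclear g hg)
  refine ⟨⟨h1, h2⟩, ?_, h2.1.2⟩
  have h3 := hX1.erase (mir (p, q))
  rw [List.erase_cons_head] at h3
  refine (h3.append_right [(tau q, tau r), (tau r, tau p)]).trans ?_
  classical
  rw [List.perm_iff_count]
  intro f
  simp only [sym, List.count_append, List.count_cons, List.map_cons, mir_mk, List.count_nil]
  ring

/-! ### Factorizations and reordering of edge lists -/

/-- Two links are related by admissible `R̃` and `W̃` moves and their inverses. -/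
def Fac : PolyLink → PolyLink → Prop :=
  Relation.ReflTransGen
    (fun X Y => RtilStep X Y ∨ RtilStep Y X ∨ AdmWtilStep X Y ∨ AdmWtilStep Y X)

lemma Fac.trans {X Y Z : PolyLink} (h : Fac X Y) (h' : Fac Y Z) : Fac X Z :=
  Relation.ReflTransGen.trans h h'

lemma Fac.symm {X Y : PolyLink} (h : Fac X Y) : Fac Y X := by
  refine Relation.ReflTransGen.mono ?_ _ _ (Relation.reflTransGen_swap.1 h)
  intro X Y h
  tauto

lemma fac_of_admWtil {a d b c : R3} {X : PolyLink} (h : AdmWtil a d b c X) :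
    Fac X (applyWtil a d b c X) :=
  Relation.ReflTransGen.single (Or.inr (Or.inr (Or.inl ⟨a, d, b, c, h, rfl⟩)))

lemma applyEtil_eq {p q r : R3} {X : PolyLink} (h : mir (p, q) ∈ X.erase (p, q)) :
    applyEtil p q r X = (X.erase (p, q)).erase (mir (p, q)) ++
      [(p, r), (r, q), (tau q, tau r), (tau r, tau p)] := by
  have h' : (tau q, tau p) ∈ X.erase (p, q) := h
  simp [applyEtil, applyE, List.erase_append_left _ h']

/-- If the same `R̃` move applies to two edge lists which differ by the position of the two
edges replaced by it, then they are related by moves. -/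
lemma fac_of_erase_eq {p q r : R3} {X Y : PolyLink} (hX : AdmRtil p q r X)
    (hY : AdmRtil p q r Y) (hXm : mir (p, q) ∈ X.erase (p, q))
    (hYm : mir (p, q) ∈ Y.erase (p, q))
    (h : (X.erase (p, q)).erase (mir (p, q)) = (Y.erase (p, q)).erase (mir (p, q))) :
    Fac X Y := by
  have h1 : Fac X (applyEtil p q r X) :=
    Relation.ReflTransGen.single (Or.inl ⟨p, q, r, hX, rfl⟩)
  have h2 : Fac Y (applyEtil p q r Y) :=
    Relation.ReflTransGen.single (Or.inl ⟨p, q, r, hY, rfl⟩)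
  rw [applyEtil_eq hXm, h, ← applyEtil_eq hYm] at h1
  exact h1.trans h2.symm

/-- Reordering four pairs of elements of a list, moving one pair at a time. -/
lemma reorder_pairs {α : Type*} [BEq α] [LawfulBEq α] {F : List α → List α → Prop}
    (htrans : ∀ X Y Z, F X Y → F Y Z → F X Z) {N : List α} {p p' q q' r r' s s' : α}
    (hnd : (N ++ [p, p', q, q', r, s, s', r']).Nodup)
    (hF : ∀ e m, (e, m) ∈ [(p, p'), (q, q'), (r, r'), (s, s')] → ∀ X Y,
      X.Perm (N ++ [p, p', q, q', r, s, s', r']) → Y.Perm (N ++ [p, p', q, q', r, s, s', r']) →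
      (X.erase e).erase m = (Y.erase e).erase m → F X Y) :
    F (N ++ [p, p', q, q', r, s, s', r']) (N ++ [s, s', r', r, q', p', p, q]) := by
  have hN : ∀ f ∈ [p, p', q, q', r, s, s', r'], f ∉ N := by
    intro f hf hfN
    exact (List.nodup_append.1 hnd).2.2 f hfN f hf rfl
  simp only [List.mem_cons, List.not_mem_nil, or_false, forall_eq_or_imp, forall_eq] at hN
  have hnd' := (List.nodup_append.1 hnd).2.1
  have hnd'' := List.nodup_reverse.2 hnd'
  simp only [List.reverse_cons, List.reverse_nil, List.nil_append, List.cons_append,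
    List.nodup_cons, List.mem_cons, List.not_mem_nil, or_false, not_or,
    List.nodup_nil, and_true, not_false_eq_true] at hnd' hnd''
  have hperm : ∀ Y : List α, (∀ f, Y.count f = [p, p', q, q', r, s, s', r'].count f) →
      (N ++ Y).Perm (N ++ [p, p', q, q', r, s, s', r']) := fun Y h =>
    (List.perm_iff_count.2 h).append_left N
  have h1 : F (N ++ [p, p', q, q', r, s, s', r']) (N ++ [p, p', q, q', r, r', s, s']) := by
    refine hF s s' (by simp) _ _ (List.Perm.refl _) (hperm _ fun f => ?_) ?_
    · simp only [List.count_cons, List.count_nil]; ring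
    · simp [List.erase_append_right, hN, hnd', hnd'']
  have h2 : F (N ++ [p, p', q, q', r, r', s, s']) (N ++ [p, p', q, q', s, s', r', r]) := by
    refine hF r r' (by simp) _ _ (hperm _ fun f => ?_) (hperm _ fun f => ?_) ?_
    · simp only [List.count_cons, List.count_nil]; ring
    · simp only [List.count_cons, List.count_nil]; ring
    · simp [List.erase_append_right, hN, hnd', hnd'']
  have h3 : F (N ++ [p, p', q, q', s, s', r', r]) (N ++ [p, p', s, s', r', r, q', q]) := by
    refine hF q q' (by simp) _ _ (hperm _ fun f => ?_) (hperm _ fun f => ?_) ?_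
    · simp only [List.count_cons, List.count_nil]; ring
    · simp only [List.count_cons, List.count_nil]; ring
    · simp [List.erase_append_right, hN, hnd', hnd'']
  have h4 : F (N ++ [p, p', s, s', r', r, q', q]) (N ++ [s, s', r', r, q', p', p, q]) := by
    refine hF p p' (by simp) _ _ (hperm _ fun f => ?_) (hperm _ fun f => ?_) ?_
    · simp only [List.count_cons, List.count_nil]; ring
    · simp only [List.count_cons, List.count_nil]; ring
    · simp [List.erase_append_right, hN, hnd'']
  exact htrans _ _ _ h1 (htrans _ _ _ h2 (htrans _ _ _ h3 h4))

lemma erase_erase_of_nodup {α : Type*} [BEq α] [LawfulBEq α] {L₁ L₂ L₃ : List α} {e m : α}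
    (h : (L₁ ++ e :: (L₂ ++ m :: L₃)).Nodup) :
    ((L₁ ++ e :: (L₂ ++ m :: L₃)).erase e).erase m = L₁ ++ (L₂ ++ L₃) := by
  simp only [List.nodup_append, List.nodup_cons, List.mem_append, List.mem_cons, not_or] at h
  obtain ⟨-, ⟨⟨he1, he2, he3⟩, h2⟩, h3⟩ := h
  have h4 : e ∉ L₁ := fun h => h3 e h e (Or.inl rfl) rfl
  have h5 : m ∉ L₁ := fun h => h3 m h m (Or.inr (Or.inr (Or.inl rfl))) rfl
  have h6 : m ∉ L₂ := fun h => h2.2.2 m h m (Or.inl rfl) rfl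
  rw [List.erase_append_right _ h4, List.erase_cons_head, List.erase_append_right _ h5,
    List.erase_append_right _ h6, List.erase_cons_head]

lemma applyEtil_of_nodup {p q r : R3} {L₁ L₂ L₃ : PolyLink}
    (h : (L₁ ++ (p, q) :: (L₂ ++ mir (p, q) :: L₃)).Nodup) :
    applyEtil p q r (L₁ ++ (p, q) :: (L₂ ++ mir (p, q) :: L₃)) = L₁ ++ (L₂ ++ (L₃ ++
      [(p, r), (r, q), (tau q, tau r), (tau r, tau p)])) := by
  have hne : (p, q) ≠ mir (p, q) := by
    intro he
    rw [← he] at h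
    have := (List.nodup_append.1 h).2.1
    simp at this
  rw [applyEtil_eq (by rw [h.mem_erase_iff]; exact ⟨hne.symm, by simp⟩),
    erase_erase_of_nodup h]
  simp

lemma applyEtil_of_nodup' {p q r : R3} {L₁ L₂ L₃ : PolyLink}
    (h : (L₁ ++ mir (p, q) :: (L₂ ++ (p, q) :: L₃)).Nodup) :
    applyEtil p q r (L₁ ++ mir (p, q) :: (L₂ ++ (p, q) :: L₃)) = L₁ ++ (L₂ ++ (L₃ ++
      [(p, r), (r, q), (tau q, tau r), (tau r, tau p)])) := by
  have hne : (p, q) ≠ mir (p, q) := by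
    intro he
    rw [← he] at h
    have := (List.nodup_append.1 h).2.1
    simp at this
  rw [applyEtil_eq (by rw [h.mem_erase_iff]; exact ⟨hne.symm, by simp⟩), List.erase_comm,
    erase_erase_of_nodup h]
  simp

/-! ### Replacing one tooth by another one -/

/-- The point dividing the segment from `a` to `d` in the ratio `t : 1 - t`. -/
def lpt (a d : R3) (t : ℝ) : R3 := (1 - t) • a + t • d

lemma lpt_symm (a d : R3) (t : ℝ) : lpt d a (1 - t) = lpt a d t := by
  simp [lpt, add_comm]

lemma tau_lpt (a d : R3) (t : ℝ) : tau (lpt a d t) = lpt (tau a) (tau d) t := by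
  simp [lpt, tau]; constructor <;> ring

lemma lpt_mem_segment {a d : R3} {t : ℝ} (h0 : 0 ≤ t) (h1 : t ≤ 1) :
    lpt a d t ∈ segment ℝ a d := ⟨1 - t, t, by linarith, h0, by ring, rfl⟩

lemma lpt_zero (a d : R3) : lpt a d 0 = a := by simp [lpt]

lemma lpt_one (a d : R3) : lpt a d 1 = d := by simp [lpt]

lemma lpt_mem_segment_left {a d : R3} {s t : ℝ} (h0 : 0 ≤ s) (h1 : s ≤ t) (h2 : 0 < t) :
    lpt a d s ∈ segment ℝ a (lpt a d t) := by
  refine ⟨1 - s / t, s / t, ?_, by positivity, by ring, ?_⟩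
  · rw [sub_nonneg, div_le_one h2]; exact h1
  · have : s / t * t = s := by field_simp
    simp only [lpt, smul_add, smul_smul, mul_sub, this, mul_one, ← add_assoc, ← add_smul]
    congr 2
    ring

lemma crossLin_lpt (a b d : R3) (s t : ℝ) :
    crossLin (proj b - proj (lpt a d s)) (lpt a d t) =
      cross2 (proj b) (proj (lpt a d s)) + (t - s) * area a b d := by
  simp [crossLin_apply, cross2, proj, lpt, area]; ring

lemma crossLin_tip (a b d : R3) (s : ℝ) :
    crossLin (proj b - proj (lpt a d s)) b = cross2 (proj b) (proj (lpt a d s)) := by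
  simp [crossLin_apply, cross2, proj, lpt]; ring

/-- Two teeth `b`, `c` on the edge `(a, d)`, together with a point `x` of the edge which allows
to pass from one to the other. -/
structure TwoTeeth (N : PolyLink) (a b c d : R3) (t : ℝ) : Prop where
  arena : Arena N {a, d} (tri a b d ∪ tri a c d)
  pos_da : PosEdge (d, a)
  pos_ab : PosEdge (a, b)
  pos_bd : PosEdge (b, d)
  pos_ac : PosEdge (a, c)
  pos_cd : PosEdge (c, d)
  t_pos : 0 < t
  t_lt : t < 1
  pos_bx : PosEdge (b, lpt a d t)
  pos_xc : PosEdge (lpt a d t, c)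
  sep : tri a b (lpt a d t) ∩ tri (lpt a d t) c d ⊆ {lpt a d t}
  link_b : IsLink (sym N [(a, b), (b, d)])
  link_c : IsLink (sym N [(a, c), (c, d)])

lemma sym_map_mir (N T : PolyLink) : (sym N (T.map mir)).Perm (sym N T) := by
  refine List.Perm.append_left N ?_
  rw [List.map_map]
  have : T.map (mir ∘ mir) = T := by simp [Function.comp_def]
  rw [this]
  exact List.perm_append_comm

lemma far_edge_subset {x c d : R3} {f : R3 × R3} (hf : f = (x, c) ∨ f = (c, d)) :
    segment ℝ f.1 f.2 ⊆ tri x c d := by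
  rcases hf with rfl | rfl
  · exact segment_left_subset_tri _ _ _
  · exact segment_right_subset_tri _ _ _

namespace TwoTeeth

variable {N : PolyLink} {a b c d : R3} {t : ℝ}

lemma symm (h : TwoTeeth N a b c d t) :
    TwoTeeth N (tau d) (tau c) (tau b) (tau a) (1 - t) where
  arena := by
    have := h.arena.symm
    rwa [Set.image_union, Set.union_comm, ← tri_tau, ← tri_tau, Set.image_pair,
      Set.pair_comm] at this
  pos_da := posEdge_mir.2 h.pos_da
  pos_ab := posEdge_mir.2 h.pos_cd
  pos_bd := posEdge_mir.2 h.pos_ac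
  pos_ac := posEdge_mir.2 h.pos_bd
  pos_cd := posEdge_mir.2 h.pos_ab
  t_pos := by linarith [h.t_lt]
  t_lt := by linarith [h.t_pos]
  pos_bx := by rw [lpt_symm, ← tau_lpt]; exact posEdge_mir.2 h.pos_xc
  pos_xc := by rw [lpt_symm, ← tau_lpt]; exact posEdge_mir.2 h.pos_bx
  sep := by
    rw [lpt_symm, ← tau_lpt, tri_tau, tri_tau, ← Set.image_inter tau_injective, Set.inter_comm]
    refine (Set.image_mono h.sep).trans (by simp)
  link_b := h.link_c.perm <| (sym_map_mir N _).symm.trans <| sym_perm (List.Perm.swap _ _ _)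
  link_c := h.link_b.perm <| (sym_map_mir N _).symm.trans <| sym_perm (List.Perm.swap _ _ _)

lemma area_pos (h : TwoTeeth N a b c d t) : 0 < area a b d := by
  have h1 : 0 < cross2 (proj d) (proj a) := h.pos_da
  have h2 : 0 < cross2 (proj a) (proj b) := h.pos_ab
  have h3 : 0 < cross2 (proj b) (proj d) := h.pos_bd
  rw [area_eq]; linarith

lemma area_pos' (h : TwoTeeth N a b c d t) : 0 < area a c d := by
  have h1 : 0 < cross2 (proj d) (proj a) := h.pos_da
  have h2 : 0 < cross2 (proj a) (proj c) := h.pos_ac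
  have h3 : 0 < cross2 (proj c) (proj d) := h.pos_cd
  rw [area_eq]; linarith

lemma ne_ad (h : TwoTeeth N a b c d t) : a ≠ d := (ne_of_area h.area_pos.ne').2.1

lemma left_ne (h : TwoTeeth N a b c d t) : a ≠ lpt a d t := by
  intro he
  have h1 : t • (d - a) = 0 := by
    have : lpt a d t - a = t • (d - a) := by simp only [lpt]; module
    rw [← this, ← he, sub_self]
  rcases smul_eq_zero.1 h1 with h1 | h1
  · exact h.t_pos.ne' h1
  · exact h.ne_ad (sub_eq_zero.1 h1).symm

lemma right_ne (h : TwoTeeth N a b c d t) : d ≠ lpt a d t := by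
  intro he
  have h1 : (1 - t) • (a - d) = 0 := by
    have : lpt a d t - d = (1 - t) • (a - d) := by simp only [lpt]; module
    rw [← this, ← he, sub_self]
  rcases smul_eq_zero.1 h1 with h1 | h1
  · linarith [h.t_lt]
  · exact h.ne_ad (sub_eq_zero.1 h1)

lemma right_notMem (h : TwoTeeth N a b c d t) : d ∉ tri a b (lpt a d t) :=
  fun hd => h.right_ne (h.sep ⟨hd, right_mem_tri _ _ _⟩)

lemma left_notMem (h : TwoTeeth N a b c d t) : a ∉ tri (lpt a d t) c d :=
  fun hd => h.left_ne (h.sep ⟨left_mem_tri _ _ _, hd⟩)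

lemma mid_mem (h : TwoTeeth N a b c d t) : lpt a d t ∈ segment ℝ a d :=
  lpt_mem_segment h.t_pos.le h.t_lt.le

lemma near_subset (h : TwoTeeth N a b c d t) : tri a b (lpt a d t) ⊆ tri a b d :=
  tri_subset (convex_tri _ _ _) (left_mem_tri _ _ _) (mid_mem_tri _ _ _)
    (segment_outer_subset_tri _ _ _ h.mid_mem)

lemma far_subset (h : TwoTeeth N a b c d t) : tri (lpt a d t) c d ⊆ tri a c d :=
  tri_subset (convex_tri _ _ _) (segment_outer_subset_tri _ _ _ h.mid_mem) (mid_mem_tri _ _ _)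
    (right_mem_tri _ _ _)

/-- The first half of the passage between two teeth: a single `W̃` move. -/
lemma admWtil (h : TwoTeeth N a b c d t) {X : PolyLink}
    (hX : X.Perm (sym N [(a, b), (b, d)])) :
    AdmWtil b d (lpt a d t) c X ∧ (applyWtil b d (lpt a d t) c X).Perm
      (sym N [(a, b), (b, lpt a d t), (lpt a d t, c), (c, d)]) ∧
      IsLink (applyWtil b d (lpt a d t) c X) := by
  have hΔ := h.area_pos
  have h1t : 0 < 1 - t := by linarith [h.t_lt]
  have hk := crossLin_tip a b d t
  have hka := crossLin_lpt a b d t 0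
  have hkx := crossLin_lpt a b d t t
  have hkd := crossLin_lpt a b d t 1
  rw [lpt_zero] at hka
  rw [lpt_one] at hkd
  have hneg : 0 < t * area a b d := mul_pos h.t_pos hΔ
  have hneg' : 0 < (1 - t) * area a b d := mul_pos h1t hΔ
  have hsub : tri b (lpt a d t) d ⊆ tri a b d :=
    tri_subset (convex_tri _ _ _) (mid_mem_tri _ _ _)
      (segment_outer_subset_tri _ _ _ h.mid_mem) (right_mem_tri _ _ _)
  obtain ⟨hA, hP, hL⟩ := h.arena.admEtil (X := X) (p := b) (q := d) (r := lpt a d t)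
    (T := [(a, b)]) (hX.trans (sym_perm (List.Perm.swap _ _ _))) (h.link_b.perm hX.symm)
    (by
      have : area b (lpt a d t) d = (t - 1) * area a b d := by
        simp [area, cross2, proj, lpt]; ring
      rw [this]; exact mul_ne_zero (by linarith) hΔ.ne')
    (by simpa using (segment_left_subset_tri a b d).trans Set.subset_union_left)
    (hsub.trans Set.subset_union_left)
    (by
      have ha : a ∉ tri b (lpt a d t) d :=
        notMem_tri_of_lt (-crossLin (proj b - proj (lpt a d t)))
          (k := -cross2 (proj b) (proj (lpt a d t)))
          (by simp [hk]) (by simp [hkx]) (by simp only [LinearMap.neg_apply]; linarith)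
          (by simp only [LinearMap.neg_apply]; linarith)
      rintro y ⟨hy, rfl | rfl⟩
      · exact absurd hy ha
      · simp)
    (by
      have := tri_inter_segment_subset (-crossLin (proj b - proj (lpt a d t)))
          (k := -cross2 (proj b) (proj (lpt a d t))) (a := b) (b := lpt a d t) (c := d)
          (u := b) (v := a)
          (by simp [hk]) (by simp [hkx]) (by simp only [LinearMap.neg_apply]; linarith)
          (by simp [hk]) (by simp only [LinearMap.neg_apply]; linarith)
      rw [segment_symm] at this
      simpa using this.trans (by simp))
  obtain ⟨hA', hP', hL'⟩ := h.arena.admEtil (X := applyEtil b d (lpt a d t) X)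
    (p := lpt a d t) (q := d) (r := c) (T := [(b, lpt a d t), (a, b)])
    (hP.trans (sym_perm (List.Perm.swap _ _ _))) hL
    (by
      have : area (lpt a d t) c d = (1 - t) * area a c d := by
        simp [area, cross2, proj, lpt]; ring
      rw [this]; exact mul_ne_zero h1t.ne' h.area_pos'.ne')
    (by
      simp only [List.mem_cons, List.not_mem_nil, or_false, forall_eq_or_imp, forall_eq]
      exact ⟨((segment_right_subset_tri _ _ _).trans h.near_subset).trans Set.subset_union_left,
        (segment_left_subset_tri a b d).trans Set.subset_union_left⟩)
    (h.far_subset.trans Set.subset_union_right)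
    (by
      rintro y ⟨hy, rfl | rfl⟩
      · exact absurd hy h.left_notMem
      · simp)
    (by
      have hs : ∀ S ⊆ tri a b (lpt a d t), tri (lpt a d t) c d ∩ S ⊆ {lpt a d t, d} :=
        fun S hS y hy => Or.inl (h.sep ⟨hS hy.2, hy.1⟩)
      simp only [List.mem_cons, List.not_mem_nil, or_false, forall_eq_or_imp, forall_eq]
      exact ⟨hs _ (segment_right_subset_tri _ _ _), hs _ (segment_left_subset_tri _ _ _)⟩)
  refine ⟨⟨h.pos_bx, h.pos_xc, h.pos_cd, h.pos_bd, ?_, hA, hA'⟩,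
    hP'.trans (sym_perm ?_), hL'⟩
  · have h1 : cross2 (proj d) (proj (lpt a d t)) = (1 - t) * cross2 (proj d) (proj a) := by
      simp [cross2, proj, lpt]; ring
    simp only [PosEdge, h1]
    exact mul_pos h1t h.pos_da
  · classical
    rw [List.perm_iff_count]
    intro f
    simp only [List.count_cons, List.count_nil]
    ring

lemma exists_between (h : TwoTeeth N a b c d t) :
    ∃ s, 0 < s ∧ s < t ∧ PosEdge (b, lpt a d s) := by
  have h2 : 0 < cross2 (proj a) (proj b) := h.pos_ab
  have h3 : 0 < cross2 (proj b) (proj d) := h.pos_bd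
  have h4 : 0 < cross2 (proj b) (proj (lpt a d t)) := h.pos_bx
  have key : ∀ s, cross2 (proj b) (proj (lpt a d s)) =
      s * (cross2 (proj a) (proj b) + cross2 (proj b) (proj d)) - cross2 (proj a) (proj b) := by
    intro s; simp [cross2, proj, lpt]; ring
  set u := cross2 (proj a) (proj b)
  set w := u + cross2 (proj b) (proj d) with hw
  have hwpos : 0 < w := by linarith
  rw [key] at h4
  have hlt : u / w < t := by rw [div_lt_iff₀ hwpos]; linarith
  have hpos : 0 < u / w := by positivity
  refine ⟨(u / w + t) / 2, by linarith, by linarith, ?_⟩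
  simp only [PosEdge, key]
  have : u / w * w = u := by field_simp
  linarith

lemma exists_admRtil_mid (h : TwoTeeth N a b c d t) : ∃ r, ∀ X : PolyLink,
    X.Perm (sym N [(a, b), (b, lpt a d t), (lpt a d t, c), (c, d)]) → IsLink X →
      AdmRtil b (lpt a d t) r X := by
  obtain ⟨s, hs0, hst, hbs⟩ := h.exists_between
  refine ⟨lpt a d s, fun X hX hL => ?_⟩
  have hΔ := h.area_pos
  have hk := crossLin_tip a b d s
  have hka := crossLin_lpt a b d s 0
  have hks := crossLin_lpt a b d s s
  have hkx := crossLin_lpt a b d s t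
  rw [lpt_zero] at hka
  have hneg : 0 < s * area a b d := mul_pos hs0 hΔ
  have hneg' : 0 < (t - s) * area a b d := mul_pos (by linarith) hΔ
  have hsub : tri b (lpt a d s) (lpt a d t) ⊆ tri a b (lpt a d t) :=
    tri_subset (convex_tri _ _ _) (mid_mem_tri _ _ _)
      (segment_outer_subset_tri _ _ _ (lpt_mem_segment_left hs0.le hst.le h.t_pos))
      (right_mem_tri _ _ _)
  have hsub' := (hsub.trans h.near_subset).trans
    (Set.subset_union_left (t := tri a c d))
  have hp : X.Perm (sym N [(b, lpt a d t), (a, b), (lpt a d t, c), (c, d)]) :=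
    hX.trans (sym_perm (List.Perm.swap _ _ _))
  refine ⟨(h.arena.admEtil hp hL ?_ ?_ hsub' ?_ ?_).1, hbs, h.pos_bx, ?_⟩
  · have : area b (lpt a d s) (lpt a d t) = (s - t) * area a b d := by
      simp [area, cross2, proj, lpt]; ring
    rw [this]; exact mul_ne_zero (by linarith) hΔ.ne'
  · intro f hf
    simp only [List.mem_cons, List.not_mem_nil, or_false] at hf
    rcases hf with rfl | hf
    · exact (segment_left_subset_tri a b d).trans Set.subset_union_left
    · exact ((far_edge_subset hf).trans h.far_subset).trans Set.subset_union_right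
  · have ha : a ∉ tri b (lpt a d s) (lpt a d t) :=
      notMem_tri_of_lt (-crossLin (proj b - proj (lpt a d s)))
        (k := -cross2 (proj b) (proj (lpt a d s)))
        (by simp [hk]) (by simp [hks]) (by simp only [LinearMap.neg_apply]; linarith)
        (by simp only [LinearMap.neg_apply]; linarith)
    rintro y ⟨hy, rfl | rfl⟩
    · exact absurd hy ha
    · exact absurd (hsub hy) h.right_notMem
  · intro f hf
    simp only [List.mem_cons, List.not_mem_nil, or_false] at hf
    rcases hf with rfl | hf
    · have := tri_inter_segment_subset (-crossLin (proj b - proj (lpt a d s)))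
          (k := -cross2 (proj b) (proj (lpt a d s))) (a := b) (b := lpt a d s)
          (c := lpt a d t) (u := b) (v := a)
          (by simp [hk]) (by simp [hks]) (by simp only [LinearMap.neg_apply]; linarith)
          (by simp [hk]) (by simp only [LinearMap.neg_apply]; linarith)
      rw [segment_symm] at this
      exact this.trans (by simp)
    · exact fun y hy => Or.inr (h.sep ⟨hsub hy.1, far_edge_subset hf hy.2⟩)
  · have h1 : cross2 (proj (lpt a d t)) (proj (lpt a d s)) =
        (t - s) * cross2 (proj d) (proj a) := by
      simp [cross2, proj, lpt]; ring
    simp only [PosEdge, h1]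
    exact mul_pos (by linarith) h.pos_da

lemma exists_admRtil_left (h : TwoTeeth N a b c d t) : ∃ r, ∀ X : PolyLink,
    X.Perm (sym N [(a, b), (b, lpt a d t), (lpt a d t, c), (c, d)]) → IsLink X →
      AdmRtil a b r X := by
  obtain ⟨s, hs0, hst, hbs⟩ := h.exists_between
  have hw : 0 < cross2 (proj d) (proj a) := h.pos_da
  have hu : 0 < cross2 (proj a) (proj b) := h.pos_ab
  have hbs' : 0 < cross2 (proj b) (proj (lpt a d s)) := hbs
  set u := cross2 (proj a) (proj b) with hudef
  set w := s * cross2 (proj d) (proj a) + u with hwdef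
  have hwpos : 0 < w := by positivity
  obtain ⟨ε, hε0, hε1, hεu⟩ : ∃ ε, 0 < ε ∧ ε ≤ 1 ∧ ε * w < u := by
    refine ⟨u / (2 * w), by positivity, ?_, ?_⟩
    · rw [div_le_one (by positivity)]
      have : 0 < s * cross2 (proj d) (proj a) := by positivity
      linarith
    · have : u / (2 * w) * w = u / 2 := by field_simp
      linarith
  refine ⟨lpt b (lpt a d s) ε, fun X hX hL => ?_⟩
  have hΔ := h.area_pos
  have hk := crossLin_tip a b d s
  have hka := crossLin_lpt a b d s 0
  have hks := crossLin_lpt a b d s s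
  have hkx := crossLin_lpt a b d s t
  rw [lpt_zero] at hka
  have hneg : 0 < s * area a b d := mul_pos hs0 hΔ
  have hneg' : 0 < (t - s) * area a b d := mul_pos (by linarith) hΔ
  have hsub0 : tri a (lpt b (lpt a d s) ε) b ⊆ tri a b (lpt a d s) :=
    tri_subset (convex_tri _ _ _) (left_mem_tri _ _ _)
      (segment_right_subset_tri _ _ _ (lpt_mem_segment hε0.le hε1)) (mid_mem_tri _ _ _)
  have hsub : tri a (lpt b (lpt a d s) ε) b ⊆ tri a b (lpt a d t) :=
    hsub0.trans <| tri_subset (convex_tri _ _ _) (left_mem_tri _ _ _) (mid_mem_tri _ _ _)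
      (segment_outer_subset_tri _ _ _ (lpt_mem_segment_left hs0.le hst.le h.t_pos))
  have hsub' := (hsub.trans h.near_subset).trans
    (Set.subset_union_left (t := tri a c d))
  refine ⟨(h.arena.admEtil hX hL ?_ ?_ hsub' ?_ ?_).1, ?_, h.pos_ab, ?_⟩
  · have : area a (lpt b (lpt a d s) ε) b = -(ε * s) * area a b d := by
      simp [area, cross2, proj, lpt]; ring
    rw [this]; exact mul_ne_zero (by simp [hε0.ne', hs0.ne']) hΔ.ne'
  · intro f hf
    simp only [List.mem_cons, List.not_mem_nil, or_false] at hf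
    rcases hf with rfl | hf
    · exact ((segment_right_subset_tri _ _ _).trans h.near_subset).trans Set.subset_union_left
    · exact ((far_edge_subset hf).trans h.far_subset).trans Set.subset_union_right
  · rintro y ⟨hy, rfl | rfl⟩
    · simp
    · exact absurd (hsub hy) h.right_notMem
  · intro f hf
    simp only [List.mem_cons, List.not_mem_nil, or_false] at hf
    have h1 : crossLin (proj b - proj (lpt a d s)) a ≤ cross2 (proj b) (proj (lpt a d s)) := by
      linarith
    have h2 : cross2 (proj b) (proj (lpt a d s)) <
        crossLin (proj b - proj (lpt a d s)) (lpt a d t) := by linarith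
    have h3 : crossLin (proj b - proj (lpt a d s)) (lpt a d s) ≤
        cross2 (proj b) (proj (lpt a d s)) := by linarith
    rcases hf with rfl | hf
    · have := tri_inter_segment_subset (crossLin (proj b - proj (lpt a d s)))
          h1 hk.le h3 hk h2
      exact ((Set.inter_subset_inter_left _ hsub0).trans this).trans (by simp)
    · intro y hy
      have hy' := h.sep ⟨hsub hy.1, far_edge_subset hf hy.2⟩
      rw [Set.mem_singleton_iff] at hy'
      exact absurd (hy' ▸ hsub0 hy.1) (notMem_tri_of_lt _ h1 hk.le h3 h2)
  · have h1 : cross2 (proj a) (proj (lpt b (lpt a d s) ε)) = u - ε * w := by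
      simp [hudef, hwdef, cross2, proj, lpt]; ring
    simp only [PosEdge, h1]
    linarith
  · have h1 : cross2 (proj b) (proj (lpt b (lpt a d s) ε)) =
        ε * cross2 (proj b) (proj (lpt a d s)) := by
      simp [cross2, proj, lpt]; ring
    simp only [PosEdge, h1]
    positivity

/-- Passing from one tooth to the other. -/
lemma fac (h : TwoTeeth N a b c d t) :
    Fac (N ++ [(a, b), (b, d), mir (b, d), mir (a, b)])
      (N ++ [(a, c), (c, d), mir (c, d), mir (a, c)]) := by
  set x := lpt a d t with hx
  have hx' : tau x = lpt (tau d) (tau a) (1 - t) := by rw [lpt_symm, hx, tau_lpt]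
  have hb : (N ++ [(a, b), (b, d), mir (b, d), mir (a, b)]).Perm (sym N [(a, b), (b, d)]) :=
    List.Perm.append_left N (((List.Perm.swap _ _ _).cons _).cons _)
  have hc : (N ++ [(a, c), (c, d), mir (c, d), mir (a, c)]).Perm
      (sym N [(tau d, tau c), (tau c, tau a)]) := by
    refine List.Perm.trans ?_ (sym_map_mir N [(c, d), (a, c)]).symm
    refine List.Perm.append_left N ?_
    exact (List.Perm.swap _ _ _)
  obtain ⟨hW, hP, hL⟩ := h.admWtil hb
  obtain ⟨hW', -, -⟩ := h.symm.admWtil hc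
  rw [← hx'] at hW'
  have hlb : (N ++ [(a, b), (b, d), mir (b, d), mir (a, b)]).Nodup := (h.link_b.perm hb.symm).1
  have hlc : (N ++ [(a, c), (c, d), mir (c, d), mir (a, c)]).Nodup :=
    (h.symm.link_b.perm hc.symm).1
  have hb1 : applyEtil b d x (N ++ [(a, b), (b, d), mir (b, d), mir (a, b)]) =
      N ++ [(a, b), mir (a, b), (b, x), (x, d), mir (x, d), mir (b, x)] := by
    have := applyEtil_of_nodup (p := b) (q := d) (r := x) (L₁ := N ++ [(a, b)]) (L₂ := [])
      (L₃ := [mir (a, b)]) (by simpa using hlb)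
    simpa using this
  have hb2 : applyWtil b d x c (N ++ [(a, b), (b, d), mir (b, d), mir (a, b)]) =
      N ++ [(a, b), mir (a, b), (b, x), mir (b, x), (x, c), (c, d), mir (c, d), mir (x, c)] := by
    have hnd := hW.2.2.2.2.2.1.2.1.2.1
    change (applyEtil b d x (N ++ [(a, b), (b, d), mir (b, d), mir (a, b)])).Nodup at hnd
    rw [hb1] at hnd
    have := applyEtil_of_nodup (p := x) (q := d) (r := c)
      (L₁ := N ++ [(a, b), mir (a, b), (b, x)]) (L₂ := [])
      (L₃ := [mir (b, x)]) (by simpa using hnd)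
    rw [applyWtil, hb1]
    simpa using this
  have hc1 : applyEtil (tau c) (tau a) (tau x)
      (N ++ [(a, c), (c, d), mir (c, d), mir (a, c)]) =
      N ++ [(c, d), mir (c, d), mir (x, c), mir (a, x), (a, x), (x, c)] := by
    have := applyEtil_of_nodup' (p := tau c) (q := tau a) (r := tau x) (L₁ := N)
      (L₂ := [(c, d), mir (c, d)]) (L₃ := []) (by simpa using hlc)
    simpa using this
  have hc2 : applyWtil (tau c) (tau a) (tau x) (tau b)
      (N ++ [(a, c), (c, d), mir (c, d), mir (a, c)]) =
      N ++ [(c, d), mir (c, d), mir (x, c), (x, c), mir (b, x), mir (a, b), (a, b), (b, x)] := by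
    have hnd := hW'.2.2.2.2.2.1.2.1.2.1
    change (applyEtil (tau c) (tau a) (tau x)
      (N ++ [(a, c), (c, d), mir (c, d), mir (a, c)])).Nodup at hnd
    rw [hc1] at hnd
    have := applyEtil_of_nodup (p := tau x) (q := tau a) (r := tau b)
      (L₁ := N ++ [(c, d), mir (c, d), mir (x, c)]) (L₂ := [])
      (L₃ := [(x, c)]) (by simpa using hnd)
    rw [applyWtil, hc1]
    simpa using this
  rw [hb2] at hP hL
  obtain ⟨r₁, hr₁⟩ := h.exists_admRtil_left
  obtain ⟨r₂, hr₂⟩ := h.exists_admRtil_mid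
  obtain ⟨r₃, hr₃⟩ := h.symm.exists_admRtil_left
  obtain ⟨r₄, hr₄⟩ := h.symm.exists_admRtil_mid
  rw [← hx] at hr₁ hr₂ hP
  rw [← hx'] at hr₃ hr₄
  have hsymm : (sym N [(a, b), (b, x), (x, c), (c, d)]).Perm
      (sym N [(tau d, tau c), (tau c, tau x), (tau x, tau b), (tau b, tau a)]) := by
    refine (sym_map_mir N _).symm.trans (sym_perm ?_)
    exact (List.reverse_perm _).symm
  have hmem : ∀ {X : PolyLink} (p q : R3), X.Perm (N ++ [(a, b), mir (a, b), (b, x),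
      mir (b, x), (x, c), (c, d), mir (c, d), mir (x, c)]) →
      (p, q) ∈ [(a, b), (b, x), (tau d, tau c), (tau c, tau x)] →
      mir (p, q) ∈ X.erase (p, q) := by
    intro X p q hX hpq
    have hnd := hL.1
    rw [(hX.nodup_iff.2 hnd).mem_erase_iff, hX.mem_iff]
    have hnd' := (List.nodup_append.1 hnd).2.1
    have hnd'' := List.nodup_reverse.2 hnd'
    simp only [List.reverse_cons, List.reverse_nil, List.nil_append, List.cons_append, mir_mk,
      List.nodup_cons, List.mem_cons, not_or] at hnd' hnd''
    simp only [List.mem_cons, List.not_mem_nil, or_false] at hpq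
    rcases hpq with h | h | h | h <;> simp only [Prod.mk.injEq] at h <;>
      obtain ⟨rfl, rfl⟩ := h
    · exact ⟨hnd''.2.2.2.2.2.2.1.1, by simp⟩
    · exact ⟨hnd''.2.2.2.2.1.1, by simp⟩
    · simp only [mir_mk, tau_tau]
      exact ⟨hnd'.2.2.2.2.2.1.1, by simp⟩
    · simp only [mir_mk, tau_tau]
      exact ⟨hnd'.2.2.2.2.1.2.2.1, by simp⟩
  refine (hb2 ▸ fac_of_admWtil hW).trans (Fac.trans ?_ (hc2 ▸ fac_of_admWtil hW').symm)
  refine reorder_pairs (F := Fac) (fun _ _ _ => Fac.trans) hL.1 ?_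
  intro e m hem X Y hX hY hXY
  have hXL := hL.perm hX.symm
  have hYL := hL.perm hY.symm
  have hX' := hX.trans hP
  have hY' := hY.trans hP
  simp only [List.mem_cons, List.not_mem_nil, or_false, Prod.mk.injEq] at hem
  rcases hem with ⟨rfl, rfl⟩ | ⟨rfl, rfl⟩ | ⟨rfl, rfl⟩ | ⟨rfl, rfl⟩
  · exact fac_of_erase_eq (hr₁ X hX' hXL) (hr₁ Y hY' hYL) (hmem _ _ hX (by simp))
      (hmem _ _ hY (by simp)) hXY
  · exact fac_of_erase_eq (hr₂ X hX' hXL) (hr₂ Y hY' hYL) (hmem _ _ hX (by simp))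
      (hmem _ _ hY (by simp)) hXY
  · refine fac_of_erase_eq (hr₄ X (hX'.trans hsymm) hXL) (hr₄ Y (hY'.trans hsymm) hYL)
      (hmem _ _ hX (by simp)) (hmem _ _ hY (by simp)) ?_
    rw [List.erase_comm, List.erase_comm (l := Y)]
    simpa using hXY
  · refine fac_of_erase_eq (hr₃ X (hX'.trans hsymm) hXL) (hr₃ Y (hY'.trans hsymm) hYL)
      (hmem _ _ hX (by simp)) (hmem _ _ hY (by simp)) ?_
    rw [List.erase_comm, List.erase_comm (l := Y)]
    simpa using hXY

end TwoTeeth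

/-- The determinant of the vectors from `a` to `b`, `c` and `d`. -/
def det3 (a b c d : R3) : ℝ :=
  (b.1 - a.1) * ((c.2.1 - a.2.1) * (d.2.2 - a.2.2) - (c.2.2 - a.2.2) * (d.2.1 - a.2.1)) -
  (b.2.1 - a.2.1) * ((c.1 - a.1) * (d.2.2 - a.2.2) - (c.2.2 - a.2.2) * (d.1 - a.1)) +
  (b.2.2 - a.2.2) * ((c.1 - a.1) * (d.2.1 - a.2.1) - (c.2.1 - a.2.1) * (d.1 - a.1))

lemma eq_zero_of_det3 {a b c d : R3} (h : det3 a b c d ≠ 0) {v w s : ℝ}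
    (h0 : v • (b - a) + w • (c - a) + s • (d - a) = 0) : v = 0 ∧ w = 0 ∧ s = 0 := by
  have h1 := congrArg (fun x : R3 => x.1) h0
  have h2 := congrArg (fun x : R3 => x.2.1) h0
  have h3 := congrArg (fun x : R3 => x.2.2) h0
  simp only [Prod.fst_add, Prod.snd_add, Prod.smul_fst, Prod.smul_snd, Prod.fst_sub,
    Prod.snd_sub, smul_eq_mul, Prod.fst_zero, Prod.snd_zero] at h1 h2 h3
  refine ⟨?_, ?_, ?_⟩ <;> refine (mul_eq_zero.1 ?_).resolve_right h
  · simp only [det3]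
    linear_combination
      ((c.2.1 - a.2.1) * (d.2.2 - a.2.2) - (c.2.2 - a.2.2) * (d.2.1 - a.2.1)) * h1 -
      ((c.1 - a.1) * (d.2.2 - a.2.2) - (c.2.2 - a.2.2) * (d.1 - a.1)) * h2 +
      ((c.1 - a.1) * (d.2.1 - a.2.1) - (c.2.1 - a.2.1) * (d.1 - a.1)) * h3
  · simp only [det3]
    linear_combination
      -((b.2.1 - a.2.1) * (d.2.2 - a.2.2) - (b.2.2 - a.2.2) * (d.2.1 - a.2.1)) * h1 +
      ((b.1 - a.1) * (d.2.2 - a.2.2) - (b.2.2 - a.2.2) * (d.1 - a.1)) * h2 -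
      ((b.1 - a.1) * (d.2.1 - a.2.1) - (b.2.1 - a.2.1) * (d.1 - a.1)) * h3
  · simp only [det3]
    linear_combination
      ((b.2.1 - a.2.1) * (c.2.2 - a.2.2) - (b.2.2 - a.2.2) * (c.2.1 - a.2.1)) * h1 -
      ((b.1 - a.1) * (c.2.2 - a.2.2) - (b.2.2 - a.2.2) * (c.1 - a.1)) * h2 +
      ((b.1 - a.1) * (c.2.1 - a.2.1) - (b.2.1 - a.2.1) * (c.1 - a.1)) * h3

lemma tri_inter_tri_of_det3 {a b c d : R3} (h : det3 a b c d ≠ 0) {t : ℝ} (h0 : 0 < t)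
    (h1 : t < 1) : tri a b (lpt a d t) ∩ tri (lpt a d t) c d ⊆ {lpt a d t} := by
  rintro y ⟨hy, hy'⟩
  obtain ⟨u₁, v₁, w₁, hu₁, hv₁, hw₁, hs₁, rfl⟩ := mem_tri_iff.1 hy
  obtain ⟨u₂, v₂, w₂, hu₂, hv₂, hw₂, hs₂, he⟩ := mem_tri_iff.1 hy'
  obtain rfl : u₁ = 1 - v₁ - w₁ := by linarith
  obtain rfl : u₂ = 1 - v₂ - w₂ := by linarith
  have key : v₁ • (b - a) + (-v₂) • (c - a) + (w₁ * t - (1 - v₂ - w₂) * t - w₂) • (d - a) = 0 := by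
    have he' := sub_eq_zero.2 he
    rw [← he']
    simp only [lpt]
    module
  obtain ⟨hv₁', hv₂', hs⟩ := eq_zero_of_det3 h key
  obtain rfl : v₂ = 0 := by linarith
  subst hv₁'
  have hw : w₁ = 1 := by
    have h2 : 0 ≤ (1 - t) * w₂ := mul_nonneg (by linarith) hw₂
    have h3 : w₁ ≤ 1 := by linarith
    have h4 : t * (1 - w₁) = -((1 - t) * w₂) := by linear_combination -hs
    nlinarith
  subst hw
  simp

section Generic

variable {N : PolyLink} {a b c d : R3}

/-- Two teeth in general position are related by moves, if the second one is on the left of the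
first one. -/
lemma fac_of_generic_of_pos (arena : Arena N {a, d} (tri a b d ∪ tri a c d))
    (pos_da : PosEdge (d, a)) (pos_ab : PosEdge (a, b)) (pos_bd : PosEdge (b, d))
    (pos_ac : PosEdge (a, c)) (pos_cd : PosEdge (c, d))
    (link_b : IsLink (sym N [(a, b), (b, d)])) (link_c : IsLink (sym N [(a, c), (c, d)]))
    (hdet : det3 a b c d ≠ 0) (pos_cb : PosEdge (c, b)) :
    Fac (N ++ [(a, b), (b, d), mir (b, d), mir (a, b)])
      (N ++ [(a, c), (c, d), mir (c, d), mir (a, c)]) := by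
  have hw : 0 < cross2 (proj d) (proj a) := pos_da
  have h1 : 0 < cross2 (proj a) (proj b) := pos_ab
  have h2 : 0 < cross2 (proj b) (proj d) := pos_bd
  have h3 : 0 < cross2 (proj a) (proj c) := pos_ac
  have h4 : 0 < cross2 (proj c) (proj d) := pos_cd
  have h5 : 0 < cross2 (proj c) (proj b) := pos_cb
  have plucker : cross2 (proj a) (proj c) * cross2 (proj b) (proj d) -
      cross2 (proj a) (proj b) * cross2 (proj c) (proj d) =
      cross2 (proj d) (proj a) * cross2 (proj c) (proj b) := by
    simp only [cross2]; ring
  have hbx : ∀ t, cross2 (proj b) (proj (lpt a d t)) =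
      t * (cross2 (proj a) (proj b) + cross2 (proj b) (proj d)) - cross2 (proj a) (proj b) := by
    intro t; simp [cross2, proj, lpt]; ring
  have hxc : ∀ t, cross2 (proj (lpt a d t)) (proj c) =
      cross2 (proj a) (proj c) - t * (cross2 (proj a) (proj c) + cross2 (proj c) (proj d)) := by
    intro t; simp [cross2, proj, lpt]; ring
  have h6 := mul_pos hw h5
  set A := cross2 (proj a) (proj b)
  set B := cross2 (proj b) (proj d)
  set C := cross2 (proj a) (proj c)
  set D := cross2 (proj c) (proj d)
  have hlt : A / (A + B) < C / (C + D) := by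
    rw [div_lt_div_iff₀ (by positivity) (by positivity)]
    linarith
  obtain ⟨t, ht1, ht2⟩ := _root_.exists_between hlt
  have ht1' := (div_lt_iff₀ (by positivity)).1 ht1
  have ht2' := (lt_div_iff₀ (by positivity)).1 ht2
  have ht0 : 0 < t := lt_trans (by positivity) ht1
  have htlt : t < 1 := ht2.trans ((div_lt_one (by positivity)).2 (by linarith))
  exact TwoTeeth.fac
    { arena := arena, pos_da := pos_da, pos_ab := pos_ab, pos_bd := pos_bd, pos_ac := pos_ac,
      pos_cd := pos_cd, t_pos := ht0, t_lt := htlt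
      pos_bx := by simp only [PosEdge, hbx]; linarith
      pos_xc := by simp only [PosEdge, hxc]; linarith
      sep := tri_inter_tri_of_det3 hdet ht0 htlt
      link_b := link_b, link_c := link_c }

/-- Two teeth in general position are related by moves. -/
lemma fac_of_generic (arena : Arena N {a, d} (tri a b d ∪ tri a c d))
    (pos_da : PosEdge (d, a)) (pos_ab : PosEdge (a, b)) (pos_bd : PosEdge (b, d))
    (pos_ac : PosEdge (a, c)) (pos_cd : PosEdge (c, d))
    (link_b : IsLink (sym N [(a, b), (b, d)])) (link_c : IsLink (sym N [(a, c), (c, d)]))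
    (hdet : det3 a b c d ≠ 0) (hbc : cross2 (proj c) (proj b) ≠ 0) :
    Fac (N ++ [(a, b), (b, d), mir (b, d), mir (a, b)])
      (N ++ [(a, c), (c, d), mir (c, d), mir (a, c)]) := by
  rcases lt_or_gt_of_ne hbc with h | h
  · refine (fac_of_generic_of_pos (Set.union_comm _ _ ▸ arena) pos_da pos_ac pos_cd pos_ab pos_bd
      link_c link_b ?_ ?_).symm
    · have : det3 a c b d = - det3 a b c d := by simp only [det3]; ring
      rw [this]; exact neg_ne_zero.2 hdet
    · have : cross2 (proj b) (proj c) = - cross2 (proj c) (proj b) := by simp only [cross2]; ring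
      simp only [PosEdge, this]; linarith
  · exact fac_of_generic_of_pos arena pos_da pos_ab pos_bd pos_ac pos_cd link_b link_c hdet h

end Generic

/-! ### Perturbing the tip of a triangle -/

section Perturb

open Filter Topology Metric

variable {a b d v w : R3} {g : R3 → R3}

lemma eventually_tri_subset_thickening (hg : ContinuousAt g b) {δ : ℝ} (hδ : 0 < δ) :
    ∀ᶠ e in 𝓝 b, tri w (g e) v ⊆ thickening δ (tri w (g b) v) := by
  filter_upwards [hg (ball_mem_nhds _ hδ)] with e he p hp
  obtain ⟨x, y, z, hx, hy, hz, hs, rfl⟩ := mem_tri_iff.1 hp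
  refine mem_thickening_iff.2 ⟨x • w + y • g b + z • v,
    mem_tri_iff.2 ⟨x, y, z, hx, hy, hz, hs, rfl⟩, ?_⟩
  have he : ‖g e - g b‖ < δ := by simpa [dist_eq_norm] using he
  have : x • w + y • g e + z • v - (x • w + y • g b + z • v) = y • (g e - g b) := by module
  rw [dist_eq_norm, this, norm_smul, Real.norm_of_nonneg hy]
  nlinarith [norm_nonneg (g e - g b)]

lemma eventually_disjoint_tri (hg : ContinuousAt g b)
    (h : Disjoint (tri a b d) (tri w (g b) v)) :
    ∀ᶠ e in 𝓝 b, Disjoint (tri a e d) (tri w (g e) v) := by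
  obtain ⟨δ, hδ, hdis⟩ := h.exists_thickenings (isCompact_tri _ _ _) (isCompact_tri _ _ _).isClosed
  filter_upwards [eventually_tri_subset_thickening (w := a) (v := d) continuousAt_id hδ,
    eventually_tri_subset_thickening (w := w) (v := v) hg hδ] with e h1 h2
  exact hdis.mono h1 h2

lemma exists_of_mem_tri {p a e d : R3} (hp : p ∈ tri a e d) :
    ∃ x ∈ segment ℝ e d, ∃ t : ℝ, 0 ≤ t ∧ t ≤ 1 ∧ p = a + t • (x - a) := by
  rw [tri, convexHull_insert (by simp), convexHull_pair, mem_convexJoin] at hp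
  obtain ⟨y, hy, x, hx, hp⟩ := hp
  rw [Set.mem_singleton_iff] at hy
  subst hy
  rw [segment_eq_image'] at hp
  obtain ⟨t, ht, rfl⟩ := hp
  exact ⟨x, hx, t, ht.1, ht.2, rfl⟩

lemma add_smul_mem_tri {a e d x : R3} (hx : x ∈ segment ℝ e d) {t : ℝ} (h0 : 0 ≤ t)
    (h1 : t ≤ 1) : a + t • (x - a) ∈ tri a e d := by
  refine (convex_tri a e d).segment_subset (left_mem_tri a e d)
    (segment_right_subset_tri a e d hx) ?_
  rw [segment_eq_image']
  exact ⟨t, ⟨h0, h1⟩, rfl⟩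

/-- Two triangles with a common vertex `a` which avoid the sides of each other opposite to `a`
meet in `a` only. -/
lemma tri_inter_tri_subset_singleton {a e d u v : R3}
    (h : Disjoint (segment ℝ e d) (tri a u v)) (h' : Disjoint (tri a e d) (segment ℝ u v)) :
    tri a e d ∩ tri a u v ⊆ {a} := by
  rintro p ⟨hp, hp'⟩
  obtain ⟨x, hx, s, hs0, hs1, hps⟩ := exists_of_mem_tri hp
  obtain ⟨y, hy, t, ht0, ht1, hpt⟩ := exists_of_mem_tri hp'
  have hst : s • (x - a) = t • (y - a) := add_left_cancel (hps.symm.trans hpt)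
  rcases hs0.eq_or_lt with rfl | hs
  · simpa using hps
  rcases ht0.eq_or_lt with rfl | ht
  · simpa using hpt
  exfalso
  rcases le_total s t with hle | hle
  · have hy' : y = a + (s / t) • (x - a) := by
      rw [div_eq_inv_mul, mul_smul, hst, smul_smul, inv_mul_cancel₀ ht.ne']; simp
    exact Set.disjoint_left.1 h' (hy' ▸ add_smul_mem_tri hx (by positivity)
      ((div_le_one ht).2 hle)) hy
  · have hx' : x = a + (t / s) • (y - a) := by
      rw [div_eq_inv_mul, mul_smul, ← hst, smul_smul, inv_mul_cancel₀ hs.ne']; simp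
    exact Set.disjoint_left.1 h hx (hx' ▸ add_smul_mem_tri hy (by positivity)
      ((div_le_one hs).2 hle))

lemma eventually_tri_inter_subset_singleton (hg : ContinuousAt g b)
    (h : tri a b d ∩ tri a (g b) v ⊆ {a}) (hb : a ∉ segment ℝ b d)
    (hgb : a ∉ segment ℝ (g b) v) :
    ∀ᶠ e in 𝓝 b, tri a e d ∩ tri a (g e) v ⊆ {a} := by
  have h1 : Disjoint (tri d b d) (tri a (g b) v) := by
    rw [tri_outer_eq, segment_symm, Set.disjoint_left]
    intro p hp hp'
    have := h ⟨segment_right_subset_tri a b d hp, hp'⟩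
    rw [Set.mem_singleton_iff] at this
    exact hb (this ▸ hp)
  have h2 : Disjoint (tri a b d) (tri v (g b) v) := by
    rw [tri_outer_eq, segment_symm, Set.disjoint_left]
    intro p hp hp'
    have := h ⟨hp, segment_right_subset_tri a (g b) v hp'⟩
    rw [Set.mem_singleton_iff] at this
    exact hgb (this ▸ hp')
  filter_upwards [eventually_disjoint_tri hg h1, eventually_disjoint_tri hg h2] with e h1 h2
  rw [tri_outer_eq, segment_symm] at h1 h2
  exact tri_inter_tri_subset_singleton h1 h2

lemma eventually_tri_inter_segment_subset_left (hab : a ∉ segment ℝ b d) (had : a ≠ d)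
    {f : R3 × R3} (hne : f.1 ≠ f.2)
    (h : tri a b d ∩ segment ℝ f.1 f.2 ⊆ {a, d}) (haf : a = f.1 ∨ a = f.2) :
    ∀ᶠ e in 𝓝 b, tri a e d ∩ segment ℝ f.1 f.2 ⊆ {a, d} := by
  obtain ⟨v, hv, hav⟩ : ∃ v, segment ℝ f.1 f.2 = segment ℝ a v ∧ a ≠ v := by
    rcases haf with rfl | rfl
    exacts [⟨_, rfl, hne⟩, ⟨_, segment_symm _ _ _, hne.symm⟩]
  rw [hv] at h ⊢
  have hd : d ∉ segment ℝ a v := by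
    intro hd
    have hs : segment ℝ a d ⊆ {a, d} := fun p hp =>
      h ⟨segment_outer_subset_tri a b d hp,
        (convex_segment a v).segment_subset (left_mem_segment ℝ a v) hd hp⟩
    rcases hs (midpoint_mem_segment a d) with hm | hm
    · exact had ((midpoint_eq_left_iff ℝ).1 hm)
    · exact had ((midpoint_eq_right_iff ℝ).1 hm)
  have h' : tri a b d ∩ tri a v v ⊆ {a} := by
    rintro p ⟨hp, hp'⟩
    rw [tri_right_right] at hp'
    rcases h ⟨hp, hp'⟩ with hm | hm
    · exact hm
    · exact absurd (hm ▸ hp') hd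
  filter_upwards [eventually_tri_inter_subset_singleton (g := fun _ => v) continuousAt_const h' hab
    (by simpa using hav)] with e he
  rw [← tri_right_right a v]
  exact he.trans (by simp)

lemma eventually_tri_inter_segment_subset (hab : a ∉ segment ℝ b d) (hdb : d ∉ segment ℝ a b)
    (had : a ≠ d) {f : R3 × R3} (hne : f.1 ≠ f.2)
    (h : tri a b d ∩ segment ℝ f.1 f.2 ⊆ {a, d})
    (hend : segment ℝ a d ∩ segment ℝ f.1 f.2 ⊆ {f.1, f.2}) :
    ∀ᶠ e in 𝓝 b, tri a e d ∩ segment ℝ f.1 f.2 ⊆ {a, d} := by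
  by_cases haf : a ∈ segment ℝ f.1 f.2
  · exact eventually_tri_inter_segment_subset_left hab had hne h
      (hend ⟨left_mem_segment ℝ a d, haf⟩)
  by_cases hdf : d ∈ segment ℝ f.1 f.2
  · rw [tri_rev, Set.pair_comm] at h
    rw [segment_symm] at hdb
    filter_upwards [eventually_tri_inter_segment_subset_left hdb had.symm hne h
      (hend ⟨right_mem_segment ℝ a d, hdf⟩)] with e he
    rwa [tri_rev, Set.pair_comm]
  have h' : Disjoint (tri a b d) (tri f.1 f.1 f.2) := by
    rw [tri_left_left, Set.disjoint_left]
    intro p hp hp'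
    rcases h ⟨hp, hp'⟩ with hm | hm
    exacts [haf (hm ▸ hp'), hdf (hm ▸ hp')]
  filter_upwards [eventually_disjoint_tri (g := fun _ => f.1) continuousAt_const h'] with e he
  rw [tri_left_left] at he
  rw [he.inter_eq]
  exact Set.empty_subset _

/-- The tips `b` and `c` span triangles over `[a, d]` such that the first one meets the mirror
image of the second one only in common vertices of `[a, d]` and its mirror image. -/
def Apart (a d b c : R3) : Prop :=
  tri a b d ∩ tau '' tri a c d ⊆ {a, d} ∩ tau '' {a, d}

lemma Apart.symm {a d b c : R3} (h : Apart a d b c) : Apart a d c b := by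
  have := Set.image_mono (f := tau) h
  rwa [Set.image_inter tau_injective, Set.image_inter tau_injective, tau_image_image,
    tau_image_image, Set.inter_comm, Set.inter_comm (tau '' _)] at this

lemma Apart.rev {a d b c : R3} (h : Apart a d b c) : Apart d a b c := by
  unfold Apart at *
  rwa [tri_rev d b, tri_rev d c, Set.pair_comm]

lemma Apart.eventually_of_fixed (hg : ContinuousAt g b) (h : Apart a d b (g b))
    (hab : a ∉ segment ℝ b d) (hgb : a ∉ segment ℝ (g b) d) (had : a ≠ d)
    (ha : tau a = a) (hd : tau d ≠ d) : ∀ᶠ e in 𝓝 b, Apart a d e (g e) := by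
  have hW : ({a, d} : Set R3) ∩ tau '' {a, d} = {a} := by
    ext p
    simp only [Set.image_pair, ha, Set.mem_inter_iff, Set.mem_insert_iff, Set.mem_singleton_iff]
    constructor
    · rintro ⟨rfl | rfl, h | h⟩
      exacts [rfl, rfl, h, absurd h.symm hd]
    · rintro rfl
      simp
  have key : ∀ e, tri a e d ∩ tau '' tri a (g e) d = tri a e d ∩ tri a (tau (g e)) (tau d) := by
    intro e
    rw [tau_image_tri, ha]
  unfold Apart at h ⊢
  simp only [hW, key] at h ⊢
  refine eventually_tri_inter_subset_singleton (g := tau ∘ g)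
    (continuous_tau.continuousAt.comp hg) h hab fun hm => hgb ?_
  rw [Function.comp, ← tau_image_segment, mem_tau_image, ha] at hm
  exact hm

lemma Apart.eventually (hg : ContinuousAt g b) (h : Apart a d b (g b))
    (hab : a ∉ segment ℝ b d) (hdb : d ∉ segment ℝ a b)
    (hag : a ∉ segment ℝ (g b) d) (hdg : d ∉ segment ℝ a (g b)) (had : a ≠ d)
    (hmir : tau d ≠ a) (hfix : ¬ (tau a = a ∧ tau d = d)) :
    ∀ᶠ e in 𝓝 b, Apart a d e (g e) := by
  by_cases ha : tau a = a
  · exact h.eventually_of_fixed hg hab hag had ha fun hd => hfix ⟨ha, hd⟩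
  by_cases hd : tau d = d
  · rw [segment_symm] at hdb hdg
    filter_upwards [h.rev.eventually_of_fixed hg hdb hdg had.symm hd ha] with e he using he.rev
  have hmir' : tau a ≠ d := fun h => hmir (by rw [← h, tau_tau])
  have hW : ({a, d} : Set R3) ∩ tau '' {a, d} = ∅ := by
    rw [Set.image_pair, ← Set.disjoint_iff_inter_eq_empty]
    simp [ha, hd, hmir, hmir']
  unfold Apart at h ⊢
  simp only [hW, tau_image_tri] at h ⊢
  filter_upwards [eventually_disjoint_tri (g := tau ∘ g) (continuous_tau.continuousAt.comp hg)
    (Set.disjoint_iff.2 h)] with e he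
  exact Set.disjoint_iff.1 he

end Perturb

/-! ### A triangle and its mirror image -/

section SelfApart

open Filter Topology

lemma eventually_add_smul_mem_tri {a b d : R3} {x y z : ℝ} (hx : 0 < x) (hy : 0 < y) (hz : 0 < z)
    (hs : x + y + z = 1) (α β : ℝ) : ∀ᶠ t : ℝ in 𝓝 0,
    x • a + y • b + z • d + t • (α • (b - a) + β • (d - a)) ∈ tri a b d := by
  have h1 : Tendsto (fun t : ℝ => x - t * (α + β)) (𝓝 0) (𝓝 x) :=
    Continuous.tendsto' (by fun_prop) _ _ (by simp)
  have h2 : Tendsto (fun t : ℝ => y + t * α) (𝓝 0) (𝓝 y) :=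
    Continuous.tendsto' (by fun_prop) _ _ (by simp)
  have h3 : Tendsto (fun t : ℝ => z + t * β) (𝓝 0) (𝓝 z) :=
    Continuous.tendsto' (by fun_prop) _ _ (by simp)
  filter_upwards [h1.eventually_const_lt hx, h2.eventually_const_lt hy,
    h3.eventually_const_lt hz] with t h1 h2 h3
  exact mem_tri_iff.2 ⟨_, _, _, h1.le, h2.le, h3.le, by linarith, by module⟩

lemma mem_side_or_eventually_mem_tri {a b d p : R3} (hp : p ∈ tri a b d) (α β : ℝ) :
    (p ∈ segment ℝ a b ∨ p ∈ segment ℝ b d ∨ p ∈ segment ℝ a d) ∨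
      ∀ᶠ t : ℝ in 𝓝 0, p + t • (α • (b - a) + β • (d - a)) ∈ tri a b d := by
  obtain ⟨x, y, z, hx, hy, hz, hs, rfl⟩ := mem_tri_iff.1 hp
  rcases hx.eq_or_lt with rfl | hx
  · exact Or.inl (Or.inr (Or.inl ⟨y, z, hy, hz, by linarith, by simp⟩))
  rcases hy.eq_or_lt with rfl | hy
  · exact Or.inl (Or.inr (Or.inr ⟨x, z, hx.le, hz, by linarith, by simp⟩))
  rcases hz.eq_or_lt with rfl | hz
  · exact Or.inl (Or.inl ⟨x, y, hx.le, hy.le, by linarith, by simp⟩)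
  · exact Or.inr (eventually_add_smul_mem_tri hx hy hz hs α β)

lemma tau_mem_inter_iff {S : Set R3} {p : R3} : tau p ∈ S ∩ tau '' S ↔ p ∈ S ∩ tau '' S := by
  simp only [Set.mem_inter_iff, mem_tau_image, tau_tau, and_comm]

/-- If the sides of a triangle meet its mirror image only in the set `W` of common vertices,
then so does the triangle. -/
lemma apart_self {a b d : R3} (hA : area a b d ≠ 0)
    (hW : (({a, d} : Set R3) ∩ tau '' {a, d}).Subsingleton)
    (hside : ∀ p ∈ tri a b d ∩ tau '' tri a b d,
      p ∈ segment ℝ a b ∨ p ∈ segment ℝ b d ∨ p ∈ segment ℝ a d →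
      p ∈ ({a, d} : Set R3) ∩ tau '' {a, d}) : Apart a d b b := by
  have hconv : Convex ℝ (tri a b d ∩ tau '' tri a b d) := by
    rw [tau_image_tri]
    exact (convex_tri _ _ _).inter (convex_tri _ _ _)
  have hcomp : IsCompact (tri a b d ∩ tau '' tri a b d) := by
    rw [tau_image_tri]
    exact (isCompact_tri _ _ _).inter (isCompact_tri _ _ _)
  have hext : (tri a b d ∩ tau '' tri a b d).extremePoints ℝ ⊆ {a, d} ∩ tau '' {a, d} := by
    intro p hp
    by_contra hpW
    set u : R3 := (d.2.1 - a.2.1) • (b - a) + (-(b.2.1 - a.2.1)) • (d - a) with hu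
    have htu : tau u = -u := by
      simp [hu, tau, Prod.ext_iff]; ring
    have hu1 : u.1 = area a b d := by
      simp [hu, area, cross2, proj]; ring
    have hev : ∀ q ∈ tri a b d ∩ tau '' tri a b d, q ∉ ({a, d} : Set R3) ∩ tau '' {a, d} →
        ∀ᶠ t : ℝ in 𝓝 0, q + t • u ∈ tri a b d := fun q hq hqW =>
      (mem_side_or_eventually_mem_tri hq.1 _ _).resolve_left fun h => hqW (hside q hq h)
    have hneg : Tendsto (fun t : ℝ => -t) (𝓝 0) (𝓝 0) :=
      Continuous.tendsto' (by fun_prop) _ _ (by simp)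
    have h1 := hev p hp.1 hpW
    have h2 := hev (tau p) (tau_mem_inter_iff.2 hp.1) (fun h => hpW (tau_mem_inter_iff.1 h))
    have h3 : ∀ᶠ t : ℝ in 𝓝 0, p + t • u ∈ tri a b d ∩ tau '' tri a b d := by
      filter_upwards [h1, hneg.eventually h2] with t h1 h2
      refine ⟨h1, mem_tau_image.2 ?_⟩
      have : tau (p + t • u) = tau p + (-t) • u := by
        have := congrArg (fun v => tau p + t • v) htu
        simp only [smul_neg, ← neg_smul] at this
        rw [← this]
        exact (tauLin.map_add p (t • u)).trans
          (congrArg (tau p + ·) (tauLin.map_smul t u))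
      rwa [this]
    obtain ⟨t, ⟨h4, h5⟩, ht⟩ := (((h3.and (hneg.eventually h3)).filter_mono
      nhdsWithin_le_nhds).and (self_mem_nhdsWithin (s := {(0 : ℝ)}ᶜ))).exists
    have hmem : p ∈ openSegment ℝ (p + t • u) (p + (-t) • u) :=
      ⟨1 / 2, 1 / 2, by norm_num, by norm_num, by norm_num, by module⟩
    have heq := hp.2 h4 h5 hmem
    have h0 : t • u = 0 := by simpa using heq
    have hu0 : u = 0 := (smul_eq_zero.1 h0).resolve_left ht
    rw [hu0] at hu1
    exact hA hu1.symm
  unfold Apart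
  rw [← closure_convexHull_extremePoints hcomp hconv]
  refine closure_minimal (convexHull_min hext hW.convex) hW.isClosed

end SelfApart

/-! ### Teeth over an edge -/

/-- The edge `(d, a)` is positive and `N` completes `(a, d)` and its mirror image to a link,
equivariantly. -/
structure Base (N : PolyLink) (a d : R3) : Prop where
  pos_da : PosEdge (d, a)
  link : IsLink (sym N [(a, d)])
  mir_mem : ∀ f ∈ N, mir f ∈ N

/-- The point `e` is the tip of a tooth over the edge `(a, d)` which avoids the edges in `N`. -/
structure Tip (N : PolyLink) (a d e : R3) : Prop where
  pos_left : PosEdge (a, e)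
  pos_right : PosEdge (e, d)
  clear : ∀ f ∈ N, tri a e d ∩ segment ℝ f.1 f.2 ⊆ {a, d}

section Teeth

open Filter Topology

variable {N : PolyLink} {a d e e' : R3}

lemma Base.area_pos (h : Base N a d) (ht : Tip N a d e) : 0 < area a e d := by
  have h1 : 0 < cross2 (proj d) (proj a) := h.pos_da
  have h2 : 0 < cross2 (proj a) (proj e) := ht.pos_left
  have h3 : 0 < cross2 (proj e) (proj d) := ht.pos_right
  have : area a e d =
      cross2 (proj d) (proj a) + cross2 (proj a) (proj e) + cross2 (proj e) (proj d) := by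
    simp only [area, cross2, Prod.fst_sub, Prod.snd_sub]; ring
  linarith

lemma Base.ne (h : Base N a d) : a ≠ d := by
  rintro rfl
  have := h.pos_da
  simp [PosEdge, cross2, mul_comm] at this

lemma Base.mir_ne (h : Base N a d) : mir (a, d) ≠ (a, d) := by
  have := h.link.1
  simp only [sym, List.map_cons, List.map_nil, List.nodup_append] at this
  have h2 := this.2.1
  simp at h2
  exact fun h => h2 (congrArg Prod.fst h).symm (congrArg Prod.snd h).symm

lemma Base.tau_ne (h : Base N a d) : tau d ≠ a := fun hd =>
  h.mir_ne (by rw [mir_mk, hd, ← hd, tau_tau])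

lemma Base.not_fixed (h : Base N a d) : ¬ (tau a = a ∧ tau d = d) := by
  rintro ⟨ha, hd⟩
  have h1 := congrArg Prod.fst ha
  have h2 := congrArg Prod.fst hd
  simp only [tau] at h1 h2
  have := h.pos_da
  have ha0 : a.1 = 0 := by linarith
  have hd0 : d.1 = 0 := by linarith
  simp [PosEdge, cross2, proj, ha0, hd0] at this

lemma Base.subsingleton (h : Base N a d) :
    (({a, d} : Set R3) ∩ tau '' {a, d}).Subsingleton := by
  have h1 := h.tau_ne
  have h2 : tau a ≠ d := fun h' => h1 (by rw [← h', tau_tau])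
  have h3 := h.not_fixed
  rw [Set.image_pair]
  rintro p ⟨rfl | rfl, hp | hp⟩ q ⟨rfl | rfl, hq | hq⟩ <;> first | rfl | grind

lemma Base.arena (h : Base N a d) (ht : Tip N a d e) (ht' : Tip N a d e')
    (hee : Apart a d e e) (hee' : Apart a d e e') (he'e' : Apart a d e' e') :
    Arena N {a, d} (tri a e d ∪ tri a e' d) := by
  have key : (tri a e d ∪ tri a e' d) ∩ carrier N ⊆ {a, d} := by
    rintro p ⟨hp, hpN⟩
    obtain ⟨f, hf, hpf⟩ := mem_carrier.1 hpN
    rcases hp with hp | hp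
    exacts [ht.clear f hf ⟨hp, hpf⟩, ht'.clear f hf ⟨hp, hpf⟩]
  refine ⟨key, ?_, ?_⟩
  · rintro p ⟨hp, hpN⟩
    obtain ⟨f, hf, hpf⟩ := mem_carrier.1 hpN
    refine mem_tau_image.2 (key ⟨mem_tau_image.1 hp, mem_carrier.2 ⟨_, h.mir_mem f hf, ?_⟩⟩)
    rw [segment_mir]
    exact Set.mem_image_of_mem _ hpf
  · rw [Set.image_union]
    rintro p ⟨hp | hp, hp' | hp'⟩
    exacts [hee ⟨hp, hp'⟩, hee' ⟨hp, hp'⟩, hee'.symm ⟨hp, hp'⟩, he'e' ⟨hp, hp'⟩]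

lemma Base.isLink (h : Base N a d) (ht : Tip N a d e) (hee : Apart a d e e) :
    IsLink (sym N [(a, e), (e, d)]) := by
  have := (h.arena ht ht hee hee hee).admEtil (T := []) (List.Perm.refl _) h.link
    (h.area_pos ht).ne' (by simp) Set.subset_union_left Set.inter_subset_right (by simp)
  exact this.2.2.perm this.2.1

/-- Two teeth in general position over the same edge are related by moves. -/
lemma Base.fac (h : Base N a d) (ht : Tip N a d e) (ht' : Tip N a d e')
    (hee : Apart a d e e) (hee' : Apart a d e e') (he'e' : Apart a d e' e')
    (hdet : det3 a e e' d ≠ 0) (hcross : cross2 (proj e') (proj e) ≠ 0) :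
    Fac (N ++ [(a, e), (e, d), mir (e, d), mir (a, e)])
      (N ++ [(a, e'), (e', d), mir (e', d), mir (a, e')]) :=
  fac_of_generic (h.arena ht ht' hee hee' he'e') h.pos_da ht.pos_left ht.pos_right ht'.pos_left
    ht'.pos_right (h.isLink ht hee) (h.isLink ht' he'e') hdet hcross

lemma Base.left_notMem (h : Base N a d) (ht : Tip N a d e) : a ∉ segment ℝ e d := by
  rw [segment_symm]
  refine right_notMem_segment_of_area ?_
  have : area d e a = - area a e d := by simp [area, cross2]; ring
  rw [this]
  exact neg_ne_zero.2 (h.area_pos ht).ne'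

lemma Base.right_notMem (h : Base N a d) (ht : Tip N a d e) : d ∉ segment ℝ a e :=
  right_notMem_segment_of_area (h.area_pos ht).ne'

lemma Base.eventually_tip (h : Base N a d) (ht : Tip N a d e) : ∀ᶠ x in 𝓝 e, Tip N a d x := by
  have h1 : ∀ᶠ x in 𝓝 e, PosEdge (a, x) := by
    have : Continuous fun x : R3 => cross2 (proj a) (proj x) := by
      simp only [cross2, proj]; fun_prop
    exact this.continuousAt.eventually_const_lt ht.pos_left
  have h2 : ∀ᶠ x in 𝓝 e, PosEdge (x, d) := by
    have : Continuous fun x : R3 => cross2 (proj x) (proj d) := by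
      simp only [cross2, proj]; fun_prop
    exact this.continuousAt.eventually_const_lt ht.pos_right
  have h3 : ∀ᶠ x in 𝓝 e, ∀ f ∈ {f | f ∈ N}, tri a x d ∩ segment ℝ f.1 f.2 ⊆ {a, d} := by
    refine (eventually_all_finite N.finite_toSet).2 fun f hf => ?_
    have hf' : f ∈ sym N [(a, d)] := mem_sym.2 (Or.inl hf)
    have had : (a, d) ∈ sym N [(a, d)] := mem_sym.2 (by simp)
    have hne : (a, d) ≠ f := by
      rintro rfl
      have := h.link.1
      rw [sym, List.nodup_append] at this
      exact this.2.2 _ hf _ (by simp) rfl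
    exact eventually_tri_inter_segment_subset (h.left_notMem ht) (h.right_notMem ht) h.ne
      (h.link.2.1 f hf') (ht.clear f hf)
      ((h.link.2.2.1 _ had f hf' hne).trans Set.inter_subset_right)
  filter_upwards [h1, h2, h3] with x h1 h2 h3
  exact ⟨h1, h2, h3⟩

lemma Base.eventually_apart (h : Base N a d) (ht : Tip N a d e) {g : R3 → R3}
    (hg : ContinuousAt g e) (ht' : Tip N a d (g e)) (hA : Apart a d e (g e)) :
    ∀ᶠ x in 𝓝 e, Apart a d x (g x) :=
  hA.eventually hg (h.left_notMem ht) (h.right_notMem ht) (h.left_notMem ht')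
    (h.right_notMem ht') h.ne h.tau_ne h.not_fixed

lemma eventually_add_mul_ne_zero (x : ℝ) {y : ℝ} (hy : y ≠ 0) :
    ∀ᶠ t in 𝓝[≠] (0 : ℝ), x + t * y ≠ 0 := by
  by_cases hx : x = 0
  · filter_upwards [self_mem_nhdsWithin] with t ht
    simpa [hx, hy] using ht
  · have : ContinuousAt (fun t : ℝ => x + t * y) 0 := by fun_prop
    exact (this.eventually_ne (by simpa using hx)).filter_mono nhdsWithin_le_nhds

lemma exists_direction (h : Base N a d) {b c : R3} (hb : Tip N a d b) (hc : Tip N a d c) :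
    ∃ w : R3, ∀ᶠ t in 𝓝[≠] (0 : ℝ), det3 a b (b + t • w) d ≠ 0 ∧ det3 a (b + t • w) c d ≠ 0 ∧
      cross2 (proj (b + t • w)) (proj b) ≠ 0 ∧ cross2 (proj c) (proj (b + t • w)) ≠ 0 := by
  have key : ∃ z : ℝ, det3 a b (a + (a.1, a.2.1, z)) d ≠ 0 ∧
      det3 a (a + (a.1, a.2.1, z)) c d ≠ 0 := by
    have h1 := eventually_add_mul_ne_zero (det3 a b (a + (a.1, a.2.1, 0)) d)
      (neg_ne_zero.2 (h.area_pos hb).ne')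
    have h2 := eventually_add_mul_ne_zero (det3 a (a + (a.1, a.2.1, 0)) c d)
      (h.area_pos hc).ne'
    obtain ⟨z, hz1, hz2⟩ := (h1.and h2).exists
    refine ⟨z, ?_, ?_⟩
    · convert hz1 using 1
      simp [det3, area, cross2, proj]; ring
    · convert hz2 using 1
      simp [det3, area, cross2, proj]
  obtain ⟨z, hz1, hz2⟩ := key
  have hab : cross2 (proj a) (proj b) ≠ 0 := ne_of_gt hb.pos_left
  have hca : cross2 (proj c) (proj a) ≠ 0 := by
    have : cross2 (proj c) (proj a) = - cross2 (proj a) (proj c) := by simp only [cross2]; ring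
    rw [this]
    exact neg_ne_zero.2 (ne_of_gt hc.pos_left)
  refine ⟨(a.1, a.2.1, z), ?_⟩
  filter_upwards [eventually_add_mul_ne_zero 0 hz1, eventually_add_mul_ne_zero (det3 a b c d) hz2,
    eventually_add_mul_ne_zero 0 hab, eventually_add_mul_ne_zero (cross2 (proj c) (proj b)) hca]
    with t h1 h2 h3 h4
  refine ⟨?_, ?_, ?_, ?_⟩
  · convert h1 using 1
    simp [det3]; ring
  · convert h2 using 1
    simp [det3]; ring
  · convert h3 using 1
    simp [cross2, proj]; ring
  · convert h4 using 1
    simp [cross2, proj]; ring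

/-- Two teeth over the same edge are related by moves. -/
lemma Base.fac_of_apart (h : Base N a d) {b c : R3} (hb : Tip N a d b) (hc : Tip N a d c)
    (hbb : Apart a d b b) (hbc : Apart a d b c) (hcc : Apart a d c c) :
    Fac (N ++ [(a, b), (b, d), mir (b, d), mir (a, b)])
      (N ++ [(a, c), (c, d), mir (c, d), mir (a, c)]) := by
  obtain ⟨w, hw⟩ := exists_direction h hb hc
  have hlim : Tendsto (fun t : ℝ => b + t • w) (𝓝[≠] 0) (𝓝 b) :=
    (Continuous.tendsto' (by fun_prop) _ _ (by simp)).mono_left nhdsWithin_le_nhds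
  obtain ⟨t, ⟨h1, h2, h3, h4⟩, ht, hxb, hxx, hxc⟩ := (hw.and (hlim.eventually
    ((h.eventually_tip hb).and ((h.eventually_apart hb (g := fun _ => b) continuousAt_const hb hbb
      ).and ((h.eventually_apart hb (g := id) continuousAt_id hb hbb).and
      (h.eventually_apart hb (g := fun _ => c) continuousAt_const hc hbc)))))).exists
  exact (h.fac hb ht hbb hxb.symm hxx h1 h3).trans (h.fac ht hc hxx hxc hcc h2 h4)

end Teeth

/-! ### Single-tooth sawtooth moves -/

section SingleSaw

variable {M : PolyLink} {a b c d : R3}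

/-- The edges of `M` other than `(a, d)` and its mirror image. -/
def rest (M : PolyLink) (a d : R3) : PolyLink := (M.erase (a, d)).erase (mir (a, d))

lemma mem_rest (hM : IsLink M) {f : R3 × R3} :
    f ∈ rest M a d ↔ f ∈ M ∧ f ≠ (a, d) ∧ f ≠ mir (a, d) := by
  rw [rest, (hM.1.erase _).mem_erase_iff, hM.1.mem_erase_iff]
  tauto

lemma AdmSingleSaw.ne_tip (h : AdmSingleSaw a d b M) : b ≠ a ∧ b ≠ d := by
  constructor <;> rintro rfl
  exacts [h.2.2.2.2.1 (left_mem_segment ℝ _ _), h.2.2.2.2.1 (right_mem_segment ℝ _ _)]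

lemma AdmSingleSaw.mir_ne (hM : IsLink M) (h : AdmSingleSaw a d b M) : mir (a, d) ≠ (a, d) := by
  intro hmir
  have hmem : mir (a, d) ∈ M.erase (a, d) ++ [(a, b), (b, d)] := h.2.2.2.2.2.2.1.1
  rw [hmir, List.mem_append, hM.1.mem_erase_iff] at hmem
  obtain ⟨h1, h2⟩ := h.ne_tip
  simp [h1.symm, h2.symm] at hmem

lemma AdmSingleSaw.mir_mem_erase (hM : IsLink M) (hSI : StronglyInvolutive M)
    (h : AdmSingleSaw a d b M) : mir (a, d) ∈ M.erase (a, d) :=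
  hM.1.mem_erase_iff.2 ⟨h.mir_ne hM, hSI _ h.1⟩

lemma AdmSingleSaw.applyEtil_eq (hM : IsLink M) (hSI : StronglyInvolutive M)
    (h : AdmSingleSaw a d b M) : applyEtil a d b M =
      rest M a d ++ [(a, b), (b, d), mir (b, d), mir (a, b)] :=
  _root_.applyEtil_eq (h.mir_mem_erase hM hSI)

lemma AdmSingleSaw.base (hM : IsLink M) (hSI : StronglyInvolutive M)
    (h : AdmSingleSaw a d b M) : Base (rest M a d) a d where
  pos_da := by
    have : cross2 (proj a) (proj d) < 0 := h.2.1
    simp only [PosEdge, cross2] at this ⊢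
    linarith
  link := by
    refine hM.perm (((List.perm_cons_erase h.1).trans
      ((List.perm_cons_erase (h.mir_mem_erase hM hSI)).cons _)).trans ?_)
    exact List.perm_append_comm (l₁ := [(a, d), mir (a, d)])
  mir_mem f hf := by
    rw [mem_rest hM] at hf ⊢
    refine ⟨hSI f hf.1, fun h => hf.2.2 ?_, fun h => hf.2.1 (mir_injective h)⟩
    rw [← h, mir_mir]

lemma AdmSingleSaw.tip (hM : IsLink M) (h : AdmSingleSaw a d b M) : Tip (rest M a d) a d b where
  pos_left := h.2.2.1
  pos_right := h.2.2.2.1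
  clear f hf := by
    rw [mem_rest hM] at hf
    exact h.2.2.2.2.2.1.clear hM hf.1 hf.2.1

lemma AdmSingleSaw.segment_inter (hM : IsLink M) (hSI : StronglyInvolutive M)
    (h : AdmSingleSaw a d b M) :
    segment ℝ a d ∩ tau '' segment ℝ a d ⊆ {a, d} ∩ tau '' {a, d} := by
  have := hM.2.2.1 _ h.1 _ (hSI _ h.1) (h.mir_ne hM).symm
  dsimp only at this
  rwa [segment_symm ℝ (tau d), ← tau_image_segment, Set.pair_comm (tau d), ← Set.image_pair]
    at this

lemma AdmSingleSaw.apart_self (hM : IsLink M) (hSI : StronglyInvolutive M)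
    (h : AdmSingleSaw a d b M) : Apart a d b b := by
  have hbase := h.base hM hSI
  have hseg := h.segment_inter hM hSI
  obtain ⟨h1, h2⟩ := h.2.2.2.2.2
  have hpair : ∀ {p}, p ∈ ({a, d} : Set R3) → p ∈ segment ℝ a d := by
    rintro p (rfl | rfl)
    exacts [left_mem_segment ℝ _ _, right_mem_segment ℝ _ _]
  have hmirror : tri a b d ∩ tau '' segment ℝ a d ⊆ {a, d} ∩ tau '' {a, d} := by
    intro p hp
    have := h1.clear hM (hSI _ h.1) (h.mir_ne hM)
    rw [segment_symm ℝ (tau d), ← tau_image_segment] at this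
    exact hseg ⟨hpair (this hp), hp.2⟩
  have hside : ∀ f ∈ [(a, b), (b, d)], tau '' tri a b d ∩ segment ℝ f.1 f.2 ⊆ tau '' {a, d} := by
    intro f hf
    have hne : f ≠ (tau d, tau a) := by
      rintro rfl
      have hneg : ¬ PosEdge (tau d, tau a) := by
        rw [posEdge_mir]
        exact not_lt.2 (le_of_lt h.2.1)
      simp only [List.mem_cons, List.not_mem_nil, or_false] at hf
      rcases hf with hf | hf <;> rw [hf] at hneg
      exacts [hneg h.2.2.1, hneg h.2.2.2.1]
    have := h2.clear h1.1.2 (List.mem_append_right _ hf) hne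
    rwa [tri_tau, Set.pair_comm, ← Set.image_pair] at this
  have hmem : ∀ f ∈ [(a, b), (b, d)], ∀ p ∈ tri a b d ∩ tau '' tri a b d,
      p ∈ segment ℝ f.1 f.2 → p ∈ ({a, d} : Set R3) ∩ tau '' {a, d} := by
    intro f hf p hp hpf
    refine hmirror ⟨hp.1, ?_⟩
    exact Set.image_mono (fun _ => hpair) (hside f hf ⟨hp.2, hpf⟩)
  refine _root_.apart_self (hbase.area_pos (h.tip hM)).ne' hbase.subsingleton fun p hp hps => ?_
  rcases hps with hps | hps | hps
  · exact hmem (a, b) (by simp) p hp hps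
  · exact hmem (b, d) (by simp) p hp hps
  · exact tau_mem_inter_iff.1 (hmirror ⟨mem_tau_image.1 hp.2, Set.mem_image_of_mem _ hps⟩)

/-- A `T̃` move factorizes into `R̃` and `W̃` moves and their inverses. -/
lemma fac_of_admSingleSaw (hM : IsLink M) (hSI : StronglyInvolutive M)
    (hb : AdmSingleSaw a d b M) (hc : AdmSingleSaw a d c M)
    (hadm : tri a b d ∩ tri (tau a) (tau d) (tau c) ⊆
      segment ℝ a d ∩ tau '' segment ℝ a d) :
    Fac (applyEtil a d b M) (applyEtil a d c M) := by
  rw [hb.applyEtil_eq hM hSI, hc.applyEtil_eq hM hSI]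
  refine (hb.base hM hSI).fac_of_apart (hb.tip hM) (hc.tip hM) (hb.apart_self hM hSI) ?_
    (hc.apart_self hM hSI)
  have heq : tri (tau a) (tau d) (tau c) = tau '' tri a c d := by
    rw [tau_image_tri, tri_rotate, tri_rev]
  rw [heq] at hadm
  exact hadm.trans (hb.segment_inter hM hSI)

end SingleSaw

/-- **Factorization of `T̃` moves** (Lemma `lem: Ttil`): an admissible
`T̃_{a,b,d}^c = S̃_{a,d}^c ∘ (S̃_{a,d}^b)⁻¹` move factorizes into admissible `R̃` and `W̃`
moves and their inverses. -/
theorem stmt_14 (M : PolyLink)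
    (hM : IsLink M) (hSI : StronglyInvolutive M) (hGD : GoodDiagram M)
    (a b d c : R3)
    (hb : AdmSingleSaw a d b M) (hc : AdmSingleSaw a d c M)
    (hadm : tri a b d ∩ tri (tau a) (tau d) (tau c) ⊆
      segment ℝ a d ∩ tau '' segment ℝ a d) :
    Relation.ReflTransGen
      (fun X Y => RtilStep X Y ∨ RtilStep Y X ∨ AdmWtilStep X Y ∨ AdmWtilStep Y X)
      (applyEtil a d b M) (applyEtil a d c M) := by
  exact fac_of_admSingleSaw hM hSI hb hc hadm

end
end
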